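/- Let f ∈ ℤ[X] be of degree d ≥ 2 belonging to class 𝒫₃, i.e. its derivative has the form f'(X) = g(X)²(aX+b) with g ∈ ℤ[X], a,b ∈ ℤ, a ≠ 0, and 0 is pre-periodic under f; set γ = -b/a. Assume γ is not a pre-periodic point of f. Then there exist a constant C > 0 and Q₀ (both depending only on f) such that for all Q ≥ Q₀ one has P_f(Q) ≤ C · Q / (log Q · log log Q). -/

import Mathlib

open Polynomial

/-- The `n`-th iterate of a polynomial: `f^(0) = X`, `f^(n) = f(f^(n-1))`. -/
noncomputable def polyIter {R : Type*} [CommSemiring R] (f : R[X]) : ℕ → R[X]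
  | 0 => X
  | n + 1 => f.comp (polyIter f n)

/-- A polynomial is dynamically irreducible if all its iterates `f^(n)`, `n ≥ 1`,
are irreducible. -/
def DynIrred {R : Type*} [CommSemiring R] (f : R[X]) : Prop :=
  ∀ n : ℕ, 1 ≤ n → Irreducible (polyIter f n)

/-- `γ ∈ ℚ` is pre-periodic for `f ∈ ℤ[X]` if its forward orbit `{f^(n)(γ) : n ≥ 1}`
is finite. -/
def IsPreperiodicPt (f : ℤ[X]) (γ : ℚ) : Prop :=
  {x : ℚ | ∃ n : ℕ, 1 ≤ n ∧ x = Polynomial.aeval γ (polyIter f n)}.Finite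

/-- `P_f(Q)`: the number of primes `p ∈ [Q, 2Q]` such that the reduction of `f` mod `p`
is dynamically irreducible over `𝔽_p`. -/
noncomputable def Pf (f : ℤ[X]) (Q : ℕ) : ℕ :=
  {p : ℕ | p.Prime ∧ Q ≤ p ∧ p ≤ 2 * Q ∧
    DynIrred (f.map (Int.castRingHom (ZMod p)))}.ncard

section SelbergWeights

open Finset ArithmeticFunction
open scoped ArithmeticFunction.Moebius

/-- The sum of the reciprocals of the squarefree integers up to `z`. -/
noncomputable def squarefreeHarmonic (z : ℕ) : ℝ :=
  ∑ l ∈ Icc 1 z with Squarefree l, (1 / (l : ℝ))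

theorem log_le_two_mul_squarefreeHarmonic (z : ℕ) : Real.log z ≤ 2 * squarefreeHarmonic z := by
  have h1 : Real.log z ≤ ∑ n ∈ Icc 1 z, (1 / (n : ℝ)) := by
    have := log_le_harmonic_floor (z : ℝ) (Nat.cast_nonneg z)
    rw [Nat.floor_natCast, harmonic_eq_sum_Icc] at this
    push_cast at this
    simpa using this
  have h2 : ∑ k ∈ Icc 1 z, (1 / ((k : ℝ) ^ 2)) ≤ 2 := by
    have := sum_Ioo_inv_sq_le (α := ℝ) 0 (z + 1)
    norm_num at this
    have h : Ioo 0 (z + 1) = Icc 1 z := by ext x; simp; omega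
    rw [h] at this
    simpa using this
  have h3 : ∑ n ∈ Icc 1 z, (1 / (n : ℝ)) ≤
      squarefreeHarmonic z * ∑ k ∈ Icc 1 z, (1 / ((k : ℝ) ^ 2)) := by
    rw [squarefreeHarmonic, sum_mul_sum, ← sum_product']
    have key : ∀ n ∈ Icc 1 z, (1 / (n : ℝ)) ≤
        ∑ x ∈ ((Icc 1 z).filter Squarefree ×ˢ Icc 1 z) with x.2 ^ 2 * x.1 = n,
          (1 / (x.1 : ℝ)) * (1 / (x.2 : ℝ) ^ 2) := by
      intro n hn
      rw [mem_Icc] at hn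
      obtain ⟨a, b, ha, hb, h, hs⟩ := Nat.sq_mul_squarefree_of_pos (n := n) (by omega)
      have hmem : (a, b) ∈ ((Icc 1 z).filter Squarefree ×ˢ Icc 1 z).filter
          (fun x => x.2 ^ 2 * x.1 = n) := by
        simp only [mem_filter, mem_product, mem_Icc]
        have h1 : a ≤ n := h ▸ Nat.le_mul_of_pos_left a (by positivity)
        have h2 : b ≤ n := by nlinarith [Nat.le_self_pow two_ne_zero b]
        refine ⟨⟨⟨⟨ha, by omega⟩, hs⟩, hb, by omega⟩, h⟩
      refine le_trans (le_of_eq ?_) (single_le_sum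
        (f := fun x : ℕ × ℕ => (1 / (x.1 : ℝ)) * (1 / (x.2 : ℝ) ^ 2))
        (fun x _ => by positivity) hmem)
      rw [← h]
      push_cast
      field_simp
    refine (sum_le_sum key).trans ?_
    have := sum_fiberwise_le_sum_of_sum_fiber_nonneg (s := (Icc 1 z).filter Squarefree ×ˢ Icc 1 z)
      (t := Icc 1 z) (g := fun x => x.2 ^ 2 * x.1)
      (f := fun x : ℕ × ℕ => (1 / (x.1 : ℝ)) * (1 / (x.2 : ℝ) ^ 2))
      (fun y _ => sum_nonneg fun x _ => by positivity)
    exact this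
  have hG : 0 ≤ squarefreeHarmonic z := sum_nonneg fun _ _ => by positivity
  nlinarith

theorem squarefreeHarmonic_pos {z : ℕ} (hz : 1 ≤ z) : 0 < squarefreeHarmonic z := by
  refine sum_pos' (fun _ _ => by positivity) ⟨1, ?_, by norm_num⟩
  simp [hz]

/-- The weights of the Selberg sieve of level `z`, for the sieve by all primes,
with `μ(l)/l` in place of `μ(l)/φ(l)`. -/
noncomputable def selbergWeight (z d : ℕ) : ℝ :=
  d * (∑ l ∈ Icc 1 z, if d ∣ l then (μ (l / d) : ℝ) * (μ l / l) else 0) / squarefreeHarmonic z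

theorem sum_moebius_sq_div (z : ℕ) :
    ∑ l ∈ Icc 1 z, |(μ l : ℝ)| / l = squarefreeHarmonic z := by
  rw [squarefreeHarmonic, sum_filter]
  refine sum_congr rfl fun l _ => ?_
  have := @abs_moebius l
  rw [← Int.cast_abs, this]
  split_ifs <;> simp

theorem selbergWeight_one {z : ℕ} (hz : 1 ≤ z) : selbergWeight z 1 = 1 := by
  rw [selbergWeight, div_eq_one_iff_eq (squarefreeHarmonic_pos hz).ne', ← sum_moebius_sq_div]
  simp only [Nat.cast_one, one_dvd, if_true, Nat.div_one, one_mul]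
  refine sum_congr rfl fun l _ => ?_
  rcases moebius_eq_or l with h | h | h <;> simp [h, neg_div]

theorem abs_selbergWeight_le {z d : ℕ} (hz : 1 ≤ z) : |selbergWeight z d| ≤ d := by
  have hG := squarefreeHarmonic_pos hz
  rw [selbergWeight, abs_div, abs_mul, Nat.abs_cast, abs_of_pos hG, div_le_iff₀ hG]
  refine mul_le_mul_of_nonneg_left ?_ (Nat.cast_nonneg d)
  rw [← sum_moebius_sq_div]
  refine (abs_sum_le_sum_abs _ _).trans (sum_le_sum fun l _ => ?_)
  split_ifs
  · rw [abs_mul, abs_div, Nat.abs_cast]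
    have h : |(μ (l / d) : ℝ)| ≤ 1 := by exact_mod_cast abs_moebius_le_one
    exact mul_le_of_le_one_left (by positivity) h
  · simp only [abs_zero]; positivity

theorem sum_moebius_div_of_dvd {z e l : ℕ} (he : 1 ≤ e) (hl : l ∈ Icc 1 z) :
    ∑ d ∈ Icc 1 z, (if e ∣ d ∧ d ∣ l then (μ (l / d) : ℝ) else 0) = if l = e then 1 else 0 := by
  rw [mem_Icc] at hl
  by_cases hel : e ∣ l
  · obtain ⟨k, rfl⟩ := hel
    have hk : 0 < k := Nat.pos_of_ne_zero (by rintro rfl; simp at hl)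
    rw [← sum_filter]
    have : ∑ d ∈ Icc 1 z with e ∣ d ∧ d ∣ e * k, (μ (e * k / d) : ℝ) =
        ∑ i ∈ k.divisors, (μ (k / i) : ℝ) := by
      symm
      refine sum_bij (fun i _ => e * i) ?_ ?_ ?_ ?_
      · intro i hi
        rw [Nat.mem_divisors] at hi
        have h1 := Nat.le_of_dvd hk hi.1
        have h2 := Nat.pos_of_dvd_of_pos hi.1 hk
        simp only [mem_filter, mem_Icc]
        refine ⟨⟨by nlinarith, by nlinarith⟩, dvd_mul_right _ _, Nat.mul_dvd_mul_left _ hi.1⟩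
      · intro i _ j _ h
        exact Nat.eq_of_mul_eq_mul_left he h
      · rintro d hd
        simp only [mem_filter, mem_Icc] at hd
        obtain ⟨_, ⟨i, rfl⟩, h⟩ := hd
        exact ⟨i, Nat.mem_divisors.2 ⟨Nat.dvd_of_mul_dvd_mul_left he h, hk.ne'⟩, rfl⟩
      · intro i _
        rw [Nat.mul_div_mul_left _ _ he]
    rw [this, Nat.sum_div_divisors k (fun i => (μ i : ℝ))]
    have h := congrArg (fun f => f k) (coe_moebius_mul_coe_zeta (R := ℝ))
    simp only [coe_mul_zeta_apply, intCoe_apply] at h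
    rw [h, one_apply]
    have : k = 1 ↔ e * k = e := by
      constructor
      · rintro rfl; simp
      · intro h; exact Nat.eq_of_mul_eq_mul_left he (by simpa using h)
    simp only [this]
  · rw [if_neg (by rintro rfl; exact hel dvd_rfl)]
    refine sum_eq_zero fun d _ => if_neg fun h => hel (h.1.trans h.2)

theorem sum_selbergWeight_div_of_dvd {z e : ℕ} (he : e ∈ Icc 1 z) :
    ∑ d ∈ Icc 1 z, (if e ∣ d then selbergWeight z d / d else 0) =
      μ e / e / squarefreeHarmonic z := by
  have h1 : ∀ d ∈ Icc 1 z, (if e ∣ d then selbergWeight z d / d else 0) =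
      ∑ l ∈ Icc 1 z, (if e ∣ d ∧ d ∣ l then (μ (l / d) : ℝ) else 0) *
        (μ l / l / squarefreeHarmonic z) := by
    intro d hd
    have hd0 : (d : ℝ) ≠ 0 := by
      rw [mem_Icc] at hd
      exact_mod_cast (show d ≠ 0 by omega)
    by_cases hed : e ∣ d
    · simp only [hed, if_true, true_and, selbergWeight]
      rw [mul_div_assoc, mul_div_cancel_left₀ _ hd0, sum_div]
      refine sum_congr rfl fun l _ => ?_
      split_ifs <;> ring
    · simp [hed]
  rw [sum_congr rfl h1, sum_comm]
  simp only [← sum_mul]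
  rw [sum_congr rfl fun l hl => by rw [sum_moebius_div_of_dvd (mem_Icc.1 he).1 hl]]
  simp [ite_mul, sum_ite_eq', he]

theorem sum_selbergWeight_mul_div_lcm_le {z : ℕ} (hz : 1 ≤ z) :
    ∑ d₁ ∈ Icc 1 z, ∑ d₂ ∈ Icc 1 z,
      selbergWeight z d₁ * selbergWeight z d₂ / (Nat.lcm d₁ d₂ : ℕ) ≤
        1 / squarefreeHarmonic z := by
  have hG := squarefreeHarmonic_pos hz
  have h1 : ∀ d₁ ∈ Icc 1 z, ∀ d₂ ∈ Icc 1 z,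
      selbergWeight z d₁ * selbergWeight z d₂ / (Nat.lcm d₁ d₂ : ℕ) =
      ∑ e ∈ Icc 1 z, (Nat.totient e : ℝ) * ((if e ∣ d₁ then selbergWeight z d₁ / d₁ else 0) *
        (if e ∣ d₂ then selbergWeight z d₂ / d₂ else 0)) := by
    intro d₁ hd₁ d₂ hd₂
    rw [mem_Icc] at hd₁ hd₂
    have hd1 : (d₁ : ℝ) ≠ 0 := by exact_mod_cast (show d₁ ≠ 0 by omega)
    have hd2 : (d₂ : ℝ) ≠ 0 := by exact_mod_cast (show d₂ ≠ 0 by omega)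
    have hg0 : Nat.gcd d₁ d₂ ≠ 0 := Nat.gcd_ne_zero_left (by omega)
    have hl0 : Nat.lcm d₁ d₂ ≠ 0 := Nat.lcm_ne_zero (by omega) (by omega)
    have hgcd : ((Nat.gcd d₁ d₂ : ℕ) : ℝ) =
        ∑ e ∈ Icc 1 z, if e ∣ d₁ ∧ e ∣ d₂ then (Nat.totient e : ℝ) else 0 := by
      rw [← sum_filter, ← Nat.sum_totient (Nat.gcd d₁ d₂), Nat.cast_sum]
      refine sum_congr ?_ fun _ _ => rfl
      ext e
      simp only [Nat.mem_divisors, mem_filter, mem_Icc, Nat.dvd_gcd_iff]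
      constructor
      · rintro ⟨⟨h1, h2⟩, _⟩
        have := Nat.le_of_dvd (by omega) h1
        have := Nat.pos_of_dvd_of_pos h1 (by omega)
        exact ⟨⟨by omega, by omega⟩, h1, h2⟩
      · rintro ⟨_, h⟩
        exact ⟨h, hg0⟩
    have hmul : ((Nat.gcd d₁ d₂ : ℕ) : ℝ) * (Nat.lcm d₁ d₂ : ℕ) = d₁ * d₂ := by
      exact_mod_cast Nat.gcd_mul_lcm d₁ d₂
    have : selbergWeight z d₁ * selbergWeight z d₂ / (Nat.lcm d₁ d₂ : ℕ) =
        (Nat.gcd d₁ d₂ : ℕ) * (selbergWeight z d₁ / d₁ * (selbergWeight z d₂ / d₂)) := by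
      have h3 : ((Nat.lcm d₁ d₂ : ℕ) : ℝ) ≠ 0 := by exact_mod_cast hl0
      rw [div_mul_div_comm, ← hmul]
      have h4 : ((Nat.gcd d₁ d₂ : ℕ) : ℝ) ≠ 0 := by exact_mod_cast hg0
      field_simp
    rw [this, hgcd, sum_mul]
    refine sum_congr rfl fun e _ => ?_
    by_cases h1 : e ∣ d₁ <;> by_cases h2 : e ∣ d₂ <;> simp [h1, h2]
  rw [sum_congr rfl fun d₁ hd₁ => sum_congr rfl fun d₂ hd₂ => h1 d₁ hd₁ d₂ hd₂]
  rw [sum_congr rfl fun d₁ _ => sum_comm, sum_comm]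
  have h2 : ∀ e ∈ Icc 1 z, ∑ d₁ ∈ Icc 1 z, ∑ d₂ ∈ Icc 1 z, (Nat.totient e : ℝ) *
      ((if e ∣ d₁ then selbergWeight z d₁ / d₁ else 0) *
        (if e ∣ d₂ then selbergWeight z d₂ / d₂ else 0)) ≤
      |(μ e : ℝ)| / e / squarefreeHarmonic z ^ 2 := by
    intro e he
    simp only [← mul_sum]
    rw [← sum_mul, sum_selbergWeight_div_of_dvd he]
    have he1 := (mem_Icc.1 he).1
    have he0 : (0 : ℝ) < e := by exact_mod_cast he1
    have htot : (Nat.totient e : ℝ) ≤ e := by exact_mod_cast Nat.totient_le e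
    have hμ : (μ e : ℝ) * μ e = |(μ e : ℝ)| := by
      rcases moebius_eq_or e with h | h | h <;> simp [h]
    calc (Nat.totient e : ℝ) * (μ e / e / squarefreeHarmonic z * (μ e / e / squarefreeHarmonic z))
        = Nat.totient e / e * (|(μ e : ℝ)| / e / squarefreeHarmonic z ^ 2) := by
          rw [← hμ]; field_simp
      _ ≤ 1 * (|(μ e : ℝ)| / e / squarefreeHarmonic z ^ 2) := by
          refine mul_le_mul_of_nonneg_right ((div_le_one he0).2 htot) (by positivity)
      _ = _ := one_mul _
  refine (sum_le_sum h2).trans (le_of_eq ?_)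
  rw [← sum_div, sum_moebius_sq_div]
  field_simp

end SelbergWeights

section JacobiVariance

open Finset

/-- The Jacobi symbol `m ↦ J(N | m)`, extended by zero to even `m`. -/
def oddJacobi (N : ℤ) (m : ℕ) : ℤ := if Odd m then jacobiSym N m else 0

theorem oddJacobi_mul_right (N : ℤ) (m n : ℕ) :
    oddJacobi N (m * n) = oddJacobi N m * oddJacobi N n := by
  unfold oddJacobi
  by_cases hm : Odd m <;> by_cases hn : Odd n <;> simp only [Nat.odd_mul, hm, hn, and_true,
    and_false, if_true, if_false, mul_zero, zero_mul]
  exact jacobiSym.mul_right' N hm.pos.ne' hn.pos.ne'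

theorem oddJacobi_mul_left (M N : ℤ) (m : ℕ) :
    oddJacobi (M * N) m = oddJacobi M m * oddJacobi N m := by
  unfold oddJacobi
  split_ifs
  · exact jacobiSym.mul_left M N m
  · simp

theorem abs_oddJacobi_le_one (N : ℤ) (m : ℕ) : |oddJacobi N m| ≤ 1 := by
  unfold oddJacobi
  split_ifs
  · rcases jacobiSym.trichotomy N m with h | h | h <;> simp [h]
  · simp

theorem oddJacobi_mod (N : ℤ) (m : ℕ) : oddJacobi N (m % (4 * N.natAbs)) = oddJacobi N m := by
  have he : Even (4 * N.natAbs) := Even.mul_right (by decide) _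
  unfold oddJacobi
  by_cases hm : Odd m
  · rw [if_pos hm, if_pos (hm.mod_even he), ← jacobiSym.mod_right N hm]
  · rw [if_neg hm, if_neg]
    rw [Nat.not_odd_iff_even] at hm ⊢
    exact hm.mod_even he

theorem sum_range_oddJacobi_eq_zero {N : ℤ} (hN : N ≠ 0) {r : ℕ} (hr : oddJacobi N r = -1) :
    ∑ m ∈ range (4 * N.natAbs), oddJacobi N m = 0 := by
  set P := 4 * N.natAbs with hP
  have hP0 : 0 < P := by positivity
  have hcop : Nat.Coprime r P := by
    have hodd : Odd r := by
      by_contra h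
      simp [oddJacobi, h] at hr
    rw [oddJacobi, if_pos hodd] at hr
    have h1 : N.gcd r = 1 := by
      by_contra h
      have : NeZero r := ⟨hodd.pos.ne'⟩
      rw [jacobiSym.eq_zero_iff_not_coprime.2 h] at hr
      norm_num at hr
    refine Nat.Coprime.mul_right ?_ ?_
    · exact Nat.Coprime.pow_right 2 (Nat.coprime_two_right.2 hodd)
    · rw [Nat.coprime_comm]; simpa [Int.gcd] using h1
  have hmaps : Set.MapsTo (fun m => r * m % P) (range P : Finset ℕ) (range P : Finset ℕ) :=
    fun m _ => by simpa using Nat.mod_lt _ hP0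
  have hinj : Set.InjOn (fun m => r * m % P) (range P : Finset ℕ) := by
    intro m hm n hn h
    simp only [coe_range, Set.mem_Iio] at hm hn
    have : m ≡ n [MOD P] := Nat.ModEq.cancel_left_of_coprime hcop.symm h
    rwa [Nat.ModEq, Nat.mod_eq_of_lt hm, Nat.mod_eq_of_lt hn] at this
  have hb : ∑ m ∈ range P, oddJacobi N (r * m % P) = ∑ m ∈ range P, oddJacobi N m :=
    sum_nbij (fun m => r * m % P) hmaps hinj (surjOn_of_injOn_of_card_le _ hmaps hinj le_rfl)
      fun _ _ => rfl
  simp only [hP, oddJacobi_mod, oddJacobi_mul_right, hr, ← mul_sum] at hb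
  rw [← hP] at hb
  omega

theorem exists_oddJacobi_eq_neg_one {q v : ℕ} (hq : q.Prime) (hq2 : q ≠ 2) (hv : Odd v) {N : ℤ}
    (hN : ¬ (q : ℤ) ∣ N) : ∃ r, oddJacobi (q ^ v * N) r = -1 := by
  have : Fact q.Prime := ⟨hq⟩
  have hN0 : N ≠ 0 := by rintro rfl; simp at hN
  obtain ⟨c, hc⟩ := FiniteField.exists_nonsquare (F := ZMod q) (by rwa [ZMod.ringChar_zmod_n])
  have hcop : Nat.Coprime (8 * N.natAbs) q := by
    rw [Nat.coprime_comm, hq.coprime_iff_not_dvd]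
    intro h
    rcases hq.dvd_mul.1 h with h | h
    · exact hq2 ((Nat.prime_dvd_prime_iff_eq hq Nat.prime_two).1
        (hq.dvd_of_dvd_pow (show q ∣ 2 ^ 3 by norm_num; exact h)))
    · exact hN (Int.natCast_dvd.2 h)
  obtain ⟨r, hr1, hr2⟩ := Nat.chineseRemainder hcop 1 c.val
  have hr8 : r % 8 = 1 := by
    have := hr1.of_mul_right (N.natAbs)
    simpa [Nat.ModEq] using this
  have hodd : Odd r := Nat.odd_iff.2 (by omega)
  refine ⟨r, ?_⟩
  rw [oddJacobi, if_pos hodd, jacobiSym.mul_left, jacobiSym.pow_left]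
  have h1 : jacobiSym N r = 1 := by
    rw [jacobiSym.mod_right N hodd]
    have h4 : r ≡ 1 [MOD (4 * N.natAbs)] :=
      hr1.of_dvd (Nat.mul_dvd_mul_right (by norm_num) _)
    have : r % (4 * N.natAbs) = 1 := by
      rw [h4]
      exact Nat.mod_eq_of_lt (by have := Int.natAbs_pos.2 hN0; omega)
    rw [this, jacobiSym.one_right]
  have h2 : jacobiSym q r = -1 := by
    rw [jacobiSym.quadratic_reciprocity_one_mod_four' (hq.odd_of_ne_two hq2) (by omega),
      ← jacobiSym.legendreSym.to_jacobiSym, legendreSym.eq_neg_one_iff]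
    have : ((r : ℤ) : ZMod q) = c := by
      rw [Int.cast_natCast, (ZMod.natCast_eq_natCast_iff r c.val q).2 hr2, ZMod.natCast_zmod_val]
    rwa [this]
  rw [h1, h2, mul_one, hv.neg_one_pow]

theorem abs_sum_Ico_oddJacobi_le {N : ℤ} (hN : N ≠ 0) {r : ℕ} (hr : oddJacobi N r = -1)
    (a b : ℕ) : |∑ m ∈ Ico a b, oddJacobi N m| ≤ 8 * |N| := by
  have hsum := sum_range_oddJacobi_eq_zero hN hr
  set P := 4 * N.natAbs with hP
  have hP0 : 0 < P := by positivity
  have hPN : (P : ℤ) = 4 * |N| := by simp [hP]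
  have hadd : ∀ n k, ∑ m ∈ range (n + P * k), oddJacobi N m = ∑ m ∈ range n, oddJacobi N m := by
    have hper : ∀ n, oddJacobi N (n + P) = oddJacobi N n := by
      intro n
      rw [← oddJacobi_mod N (n + P), ← hP, Nat.add_mod_right, hP, oddJacobi_mod]
    have h1 : ∀ n, ∑ m ∈ range (n + P), oddJacobi N m = ∑ m ∈ range n, oddJacobi N m := by
      intro n
      induction n with
      | zero => simpa using hsum
      | succ n ih => rw [show n + 1 + P = n + P + 1 by ring, sum_range_succ, ih, hper,
          sum_range_succ]
    intro n k
    induction k with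
    | zero => simp
    | succ k ih => rw [show n + P * (k + 1) = n + P * k + P by ring, h1, ih]
  have hS : ∀ n, |∑ m ∈ range n, oddJacobi N m| ≤ P := by
    intro n
    conv_lhs => rw [← Nat.mod_add_div n P, hadd]
    refine (abs_sum_le_sum_abs _ _).trans
      ((sum_le_sum fun m _ => abs_oddJacobi_le_one N m).trans ?_)
    simp only [sum_const, card_range, nsmul_eq_mul, mul_one]
    exact_mod_cast (Nat.mod_lt n hP0).le
  rcases le_total a b with hab | hab
  · rw [sum_Ico_eq_sub _ hab]
    have := abs_sub (∑ m ∈ range b, oddJacobi N m) (∑ m ∈ range a, oddJacobi N m)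
    linarith [hS a, hS b]
  · rw [Ico_eq_empty_of_le hab]
    simp

theorem sum_Ico_ite_dvd {R : Type*} [AddCommMonoid R] (F : ℕ → R) {L : ℕ} (hL : 0 < L) (a b : ℕ) :
    ∑ m ∈ Ico a b, (if L ∣ m then F m else 0) = ∑ m ∈ Ico (a ⌈/⌉ L) (b ⌈/⌉ L), F (L * m) := by
  have hmem : ∀ m, m ∈ Ico (a ⌈/⌉ L) (b ⌈/⌉ L) ↔ L * m ∈ Ico a b := by
    intro m
    rw [mem_Ico, mem_Ico, ceilDiv_le_iff_le_smul hL, ← not_le, ← not_le, ceilDiv_le_iff_le_smul hL,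
      smul_eq_mul]
  rw [← sum_filter]
  symm
  refine sum_bij (fun m _ => L * m) ?_ ?_ ?_ ?_
  · intro m hm
    exact mem_filter.2 ⟨(hmem m).1 hm, dvd_mul_right _ _⟩
  · intro m _ n _ h
    exact Nat.eq_of_mul_eq_mul_left hL h
  · intro m hm
    obtain ⟨h, k, rfl⟩ := mem_filter.1 hm
    exact ⟨k, (hmem k).2 h, rfl⟩
  · intros; rfl

theorem abs_sum_Ico_dvd_sub_le {L : ℕ} (hL : 0 < L) {a b : ℕ} (hab : a ≤ b) :
    |∑ m ∈ Ico a b, (if L ∣ m then (1 : ℝ) else 0) - (b - a) / L| ≤ 1 := by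
  have hL' : (0 : ℝ) < L := by exact_mod_cast hL
  have key : ∀ n : ℕ, (n : ℝ) / L ≤ (n ⌈/⌉ L : ℕ) ∧ ((n ⌈/⌉ L : ℕ) : ℝ) < n / L + 1 := by
    intro n
    constructor
    · rw [div_le_iff₀' hL']
      exact_mod_cast (ceilDiv_le_iff_le_smul hL).1 (le_refl (n ⌈/⌉ L))
    · rw [Nat.ceilDiv_eq_add_pred_div]
      have := Nat.div_mul_le_self (n + L - 1) L
      have h : ((n + L - 1) / L) * L < n + L := by omega
      have h' : (((n + L - 1) / L : ℕ) : ℝ) * L < n + L := by exact_mod_cast h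
      rw [div_add_one hL'.ne', lt_div_iff₀ hL']
      exact h'
  have hmono : a ⌈/⌉ L ≤ b ⌈/⌉ L := by
    rw [ceilDiv_le_iff_le_smul hL]
    exact hab.trans ((ceilDiv_le_iff_le_smul hL).1 le_rfl)
  rw [sum_Ico_ite_dvd _ hL, sum_const, Nat.card_Ico, nsmul_one, Nat.cast_sub hmono, abs_le, sub_div]
  constructor <;> linarith [key a, key b]

theorem sum_mul_sq_sum_dvd (lam : ℕ → ℝ) (z : ℕ) (s : Finset ℕ) (F : ℕ → ℝ) :
    ∑ m ∈ s, (∑ d ∈ Icc 1 z, if d ∣ m then lam d else 0) ^ 2 * F m =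
      ∑ d₁ ∈ Icc 1 z, ∑ d₂ ∈ Icc 1 z, lam d₁ * lam d₂ *
        ∑ m ∈ s, if Nat.lcm d₁ d₂ ∣ m then F m else 0 := by
  have : ∀ m ∈ s, (∑ d ∈ Icc 1 z, if d ∣ m then lam d else 0) ^ 2 * F m =
      ∑ d₁ ∈ Icc 1 z, ∑ d₂ ∈ Icc 1 z, lam d₁ * lam d₂ *
        if Nat.lcm d₁ d₂ ∣ m then F m else 0 := by
    intro m _
    rw [sq, sum_mul_sum, sum_mul]
    refine sum_congr rfl fun d₁ _ => ?_
    rw [sum_mul]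
    refine sum_congr rfl fun d₂ _ => ?_
    by_cases h1 : d₁ ∣ m <;> by_cases h2 : d₂ ∣ m <;> simp [h1, h2, Nat.lcm_dvd_iff]
  rw [sum_congr rfl this, sum_comm]
  refine sum_congr rfl fun d₁ _ => ?_
  rw [sum_comm]
  exact sum_congr rfl fun d₂ _ => (mul_sum _ _ _).symm

theorem sum_abs_selbergWeight_mul_le {z : ℕ} (hz : 1 ≤ z) :
    ∑ d₁ ∈ Icc 1 z, ∑ d₂ ∈ Icc 1 z, |selbergWeight z d₁ * selbergWeight z d₂| ≤ (z : ℝ) ^ 4 := by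
  have h : ∑ d ∈ Icc 1 z, |selbergWeight z d| ≤ (z : ℝ) ^ 2 := by
    have : ∀ d ∈ Icc 1 z, |selbergWeight z d| ≤ z := fun d hd =>
      (abs_selbergWeight_le hz).trans (by exact_mod_cast (mem_Icc.1 hd).2)
    refine (sum_le_card_nsmul _ _ _ this).trans (le_of_eq ?_)
    simp [sq]
  simp only [abs_mul]
  rw [← sum_mul_sum]
  calc _ ≤ (z : ℝ) ^ 2 * (z : ℝ) ^ 2 := mul_le_mul h h (by positivity) (by positivity)
    _ = _ := by ring

theorem sum_sq_selberg_le {z : ℕ} (hz : 1 ≤ z) {a b : ℕ} (hab : a ≤ b) :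
    ∑ m ∈ Ico a b, (∑ d ∈ Icc 1 z, if d ∣ m then selbergWeight z d else 0) ^ 2 ≤
      (b - a) / squarefreeHarmonic z + (z : ℝ) ^ 4 := by
  have h := sum_mul_sq_sum_dvd (selbergWeight z) z (Ico a b) (fun _ => 1)
  simp only [mul_one] at h
  rw [h]
  have hba : (0 : ℝ) ≤ b - a := by rw [sub_nonneg]; exact_mod_cast hab
  have h1 : ∀ d₁ ∈ Icc 1 z, ∀ d₂ ∈ Icc 1 z, selbergWeight z d₁ * selbergWeight z d₂ *
      ∑ m ∈ Ico a b, (if Nat.lcm d₁ d₂ ∣ m then (1 : ℝ) else 0) ≤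
      (b - a) * (selbergWeight z d₁ * selbergWeight z d₂ / (Nat.lcm d₁ d₂ : ℕ)) +
        |selbergWeight z d₁ * selbergWeight z d₂| := by
    intro d₁ hd₁ d₂ hd₂
    rw [mem_Icc] at hd₁ hd₂
    have := abs_sum_Ico_dvd_sub_le (Nat.lcm_pos (m := d₁) (n := d₂) (by omega) (by omega)) hab
    set S := ∑ m ∈ Ico a b, (if Nat.lcm d₁ d₂ ∣ m then (1 : ℝ) else 0)
    set c := selbergWeight z d₁ * selbergWeight z d₂
    have h2 : c * (S - (b - a) / (Nat.lcm d₁ d₂ : ℕ)) ≤ |c| := by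
      refine (le_abs_self _).trans ?_
      rw [abs_mul]
      exact mul_le_of_le_one_right (abs_nonneg _) this
    have h3 : c * S = (b - a) * (c / (Nat.lcm d₁ d₂ : ℕ)) +
      c * (S - (b - a) / (Nat.lcm d₁ d₂ : ℕ)) := by ring
    linarith
  refine (sum_le_sum fun d₁ hd₁ => sum_le_sum fun d₂ hd₂ => h1 d₁ hd₁ d₂ hd₂).trans ?_
  simp only [sum_add_distrib, ← mul_sum]
  refine add_le_add ?_ (sum_abs_selbergWeight_mul_le hz)
  rw [div_eq_mul_one_div]
  exact mul_le_mul_of_nonneg_left (sum_selbergWeight_mul_div_lcm_le hz) hba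

theorem sum_sq_selberg_mul_oddJacobi_le {z : ℕ} (hz : 1 ≤ z) {N : ℤ} (hN : N ≠ 0) {r : ℕ}
    (hr : oddJacobi N r = -1) (a b : ℕ) :
    ∑ m ∈ Ico a b, (∑ d ∈ Icc 1 z, if d ∣ m then selbergWeight z d else 0) ^ 2 *
      (oddJacobi N m : ℝ) ≤ (z : ℝ) ^ 4 * (8 * |(N : ℝ)|) := by
  rw [sum_mul_sq_sum_dvd (selbergWeight z) z (Ico a b) (fun m => (oddJacobi N m : ℝ))]
  have h1 : ∀ d₁ ∈ Icc 1 z, ∀ d₂ ∈ Icc 1 z, selbergWeight z d₁ * selbergWeight z d₂ *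
      ∑ m ∈ Ico a b, (if Nat.lcm d₁ d₂ ∣ m then (oddJacobi N m : ℝ) else 0) ≤
        |selbergWeight z d₁ * selbergWeight z d₂| * (8 * |(N : ℝ)|) := by
    intro d₁ hd₁ d₂ hd₂
    rw [mem_Icc] at hd₁ hd₂
    have hL := Nat.lcm_pos (m := d₁) (n := d₂) (by omega) (by omega)
    refine (le_abs_self _).trans ?_
    rw [abs_mul]
    refine mul_le_mul_of_nonneg_left ?_ (abs_nonneg _)
    rw [sum_Ico_ite_dvd _ hL]
    have h2 := abs_sum_Ico_oddJacobi_le hN hr (a ⌈/⌉ Nat.lcm d₁ d₂) (b ⌈/⌉ Nat.lcm d₁ d₂)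
    have h3 : (∑ m ∈ Ico (a ⌈/⌉ Nat.lcm d₁ d₂) (b ⌈/⌉ Nat.lcm d₁ d₂),
        (oddJacobi N (Nat.lcm d₁ d₂ * m) : ℝ)) = ((oddJacobi N (Nat.lcm d₁ d₂) *
          ∑ m ∈ Ico (a ⌈/⌉ Nat.lcm d₁ d₂) (b ⌈/⌉ Nat.lcm d₁ d₂), oddJacobi N m : ℤ) : ℝ) := by
      simp only [oddJacobi_mul_right, ← mul_sum, Int.cast_mul, Int.cast_sum]
    rw [h3]
    have h4 : |oddJacobi N (Nat.lcm d₁ d₂) *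
        ∑ m ∈ Ico (a ⌈/⌉ Nat.lcm d₁ d₂) (b ⌈/⌉ Nat.lcm d₁ d₂), oddJacobi N m| ≤ 8 * |N| := by
      rw [abs_mul]
      exact (mul_le_of_le_one_left (abs_nonneg _) (abs_oddJacobi_le_one _ _)).trans h2
    exact_mod_cast h4
  refine (sum_le_sum fun d₁ hd₁ => sum_le_sum fun d₂ hd₂ => h1 d₁ hd₁ d₂ hd₂).trans ?_
  simp only [← sum_mul]
  exact mul_le_mul_of_nonneg_right (sum_abs_selbergWeight_mul_le hz) (by positivity)

/-- Primes in an interval modulo which all the integers `N i` are quadratic nonresidues are rare,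
provided that no product of two of the `N i` is a square. -/
theorem card_primes_nonresidue_mul_sq_le {ι : Type*} (s : Finset ι) (N : ι → ℤ)
    (hN : ∀ i ∈ s, N i ≠ 0)
    (hprod : ∀ i ∈ s, ∀ j ∈ s, i ≠ j → ∃ r, oddJacobi (N i * N j) r = -1)
    {M : ℝ} (hM : ∀ i ∈ s, |(N i : ℝ)| ≤ M) {z : ℕ} (hz : 1 ≤ z) {a b : ℕ} (hab : a ≤ b)
    (T : Finset ℕ) (hT : ∀ p ∈ T, p.Prime ∧ z < p ∧ p ∈ Ico a b ∧ ∀ i ∈ s, oddJacobi (N i) p = -1) :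
    (#T : ℝ) * (#s : ℝ) ^ 2 ≤ #s * ((b - a) / squarefreeHarmonic z + (z : ℝ) ^ 4) +
      (#s : ℝ) ^ 2 * ((z : ℝ) ^ 4 * (8 * M ^ 2)) := by
  classical
  set w : ℕ → ℝ := fun m => (∑ d ∈ Icc 1 z, if d ∣ m then selbergWeight z d else 0) ^ 2 with hw
  have hw0 : ∀ m, 0 ≤ w m := fun m => sq_nonneg _
  have hwp : ∀ p ∈ T, w p = 1 := by
    intro p hp
    obtain ⟨hpp, hzp, -, -⟩ := hT p hp
    have : ∑ d ∈ Icc 1 z, (if d ∣ p then selbergWeight z d else 0) = selbergWeight z 1 := by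
      rw [sum_eq_single 1]
      · simp
      · intro d hd hd1
        refine if_neg fun hdp => ?_
        rw [mem_Icc] at hd
        rcases (Nat.dvd_prime hpp).1 hdp with h | h
        · exact hd1 h
        · omega
      · intro h; exact absurd (mem_Icc.2 ⟨le_rfl, hz⟩) h
    simp only [hw, this, selbergWeight_one hz, one_pow]
  have h1 : (#T : ℝ) * (#s : ℝ) ^ 2 ≤
      ∑ m ∈ Ico a b, w m * (∑ i ∈ s, (oddJacobi (N i) m : ℝ)) ^ 2 := by
    have hsub : T ⊆ Ico a b := fun p hp => (hT p hp).2.2.1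
    refine le_trans (le_of_eq ?_) (sum_le_sum_of_subset_of_nonneg hsub fun m _ _ =>
      mul_nonneg (hw0 m) (sq_nonneg _))
    rw [sum_congr rfl fun p hp => ?_, sum_const, nsmul_eq_mul]
    rw [hwp p hp, sum_congr rfl fun i hi => by rw [(hT p hp).2.2.2 i hi]]
    simp
  have h2 : ∑ m ∈ Ico a b, w m * (∑ i ∈ s, (oddJacobi (N i) m : ℝ)) ^ 2 =
      ∑ i ∈ s, ∑ j ∈ s, ∑ m ∈ Ico a b, w m * (oddJacobi (N i * N j) m : ℝ) := by
    rw [sum_congr rfl fun i _ => sum_comm, sum_comm]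
    refine sum_congr rfl fun m _ => ?_
    rw [sq, sum_mul_sum, mul_sum]
    refine sum_congr rfl fun i _ => ?_
    rw [mul_sum]
    refine sum_congr rfl fun j _ => ?_
    rw [oddJacobi_mul_left, Int.cast_mul]
  have hM2 : 0 ≤ (z : ℝ) ^ 4 * (8 * M ^ 2) := by positivity
  have h3 : ∀ i ∈ s, ∀ j ∈ s, ∑ m ∈ Ico a b, w m * (oddJacobi (N i * N j) m : ℝ) ≤
      (if i = j then (b - a) / squarefreeHarmonic z + (z : ℝ) ^ 4 else 0) +
        (z : ℝ) ^ 4 * (8 * M ^ 2) := by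
    intro i hi j hj
    split_ifs with hij
    · refine le_trans ?_ (le_add_of_nonneg_right hM2)
      refine le_trans (sum_le_sum fun m _ => ?_) (sum_sq_selberg_le hz hab)
      refine mul_le_of_le_one_right (hw0 m) ?_
      exact_mod_cast (abs_le.1 (abs_oddJacobi_le_one (N i * N j) m)).2
    · obtain ⟨r, hr⟩ := hprod i hi j hj hij
      rw [zero_add]
      refine (sum_sq_selberg_mul_oddJacobi_le hz (mul_ne_zero (hN i hi) (hN j hj)) hr a b).trans ?_
      refine mul_le_mul_of_nonneg_left ?_ (by positivity)
      rw [Int.cast_mul, abs_mul, sq]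
      have := mul_le_mul (hM i hi) (hM j hj) (abs_nonneg _) ((abs_nonneg _).trans (hM i hi))
      linarith
  rw [h2] at h1
  refine h1.trans ((sum_le_sum fun i hi => sum_le_sum fun j hj => h3 i hi j hj).trans ?_)
  simp only [sum_add_distrib, sum_const, nsmul_eq_mul, sum_ite_eq]
  rw [sum_congr rfl fun i hi => if_pos hi]
  simp only [sum_const, nsmul_eq_mul]
  nlinarith

end JacobiVariance

section Stickelberger

variable {K L : Type*} [Field K] [Finite K] [Field L] [Algebra K L] [FiniteDimensional K L]

/-- **Stickelberger's theorem** for an irreducible polynomial of even degree over a finite field: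
the discriminant is not a square. -/
theorem not_isSquare_discr_powerBasis (hK : ringChar K ≠ 2) (pb : PowerBasis K L)
    (hn : Even pb.dim) : ¬ IsSquare (Algebra.discr K pb.basis) := by
  have := Fintype.ofFinite K
  have hL : Finite L := Module.finite_of_finite K
  rintro ⟨r, hr⟩
  have hpos : 0 < pb.dim := pb.dim_pos
  obtain ⟨m, hm⟩ : ∃ m, pb.dim = m + 2 := ⟨pb.dim - 2, by obtain ⟨k, hk⟩ := hn; omega⟩
  let E := AlgebraicClosure L
  let φ : L →ₐ[K] E := IsScalarTower.toAlgHom K L E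
  let F : Gal(L/K) := FiniteField.frobeniusAlgEquivOfAlgebraic K L
  have hord : orderOf F = m + 2 := by
    rw [FiniteField.orderOf_frobeniusAlgEquivOfAlgebraic, pb.finrank, hm]
  let b : Fin (m + 2) → L := pb.basis ∘ finCongr hm.symm
  have hdisc : Algebra.discr K b = r * r := by
    rw [← hr]
    exact Algebra.discr_reindex K pb.basis (finCongr hm)
  have hinj : Function.Injective
      (fun i : Fin (m + 2) => φ.comp ((F ^ i.1 : Gal(L/K)) : L →ₐ[K] L)) := by
    intro i j h
    have h1 : (F ^ i.1 : Gal(L/K)) = F ^ j.1 := by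
      ext x
      exact φ.toRingHom.injective (DFunLike.congr_fun h x)
    have := pow_injOn_Iio_orderOf (x := F) (by simp [hord]) (by simp [hord]) h1
    exact Fin.ext this
  have hbij := (Fintype.bijective_iff_injective_and_card _).2 ⟨hinj, by
    rw [Fintype.card_fin, ← Nat.card_eq_fintype_card, Nat.card_eq_fintype_card, AlgHom.card,
      pb.finrank, hm]⟩
  let e : Fin (m + 2) ≃ (L →ₐ[K] E) := Equiv.ofBijective _ hbij
  have hsq := Algebra.discr_eq_det_embeddingsMatrixReindex_pow_two K E b e
  set D := (Algebra.embeddingsMatrixReindex K E b e).det with hD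
  let τ : E →ₐ[K] E := FiniteField.frobeniusAlgHom K E
  have hrot : ∀ i x, τ (e i x) = e (finRotate (m + 2) i) x := by
    intro i x
    have h1 : (e (finRotate (m + 2) i) : L →ₐ[K] E) x = φ ((F ^ (i.1 + 1) : Gal(L/K)) x) := by
      have : (F ^ (finRotate (m + 2) i).1 : Gal(L/K)) = F ^ (i.1 + 1) := by
        rw [finRotate_apply, Fin.val_add]
        have := pow_mod_orderOf F (i.1 + 1)
        rw [hord] at this
        simpa using this
      rw [← this]
      rfl
    rw [h1, pow_succ']
    have h2 : e i x = φ ((F ^ i.1 : Gal(L/K)) x) := rfl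
    rw [h2, AlgEquiv.mul_apply]
    simp [τ, F, FiniteField.frobeniusAlgHom_apply]
  have hτ : τ D = -D := by
    have h1 : τ D = ((Algebra.embeddingsMatrixReindex K E b e).submatrix id
        (finRotate (m + 2))).det := by
      rw [hD, AlgHom.map_det]
      congr 1
      ext i j
      exact hrot j (b i)
    rw [h1, Matrix.det_permute', sign_finRotate]
    have : Odd (m + 2 - 1) := by
      obtain ⟨k, hk⟩ := hn
      exact ⟨k - 1, by omega⟩
    rw [this.neg_one_pow]
    push_cast
    exact neg_one_mul _
  have hne : Algebra.discr K b ≠ 0 := by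
    rw [hdisc, ← hr]; exact Algebra.discr_not_zero_of_basis K pb.basis
  have hD0 : D ≠ 0 := by
    rintro h
    rw [h] at hsq
    simp [hne] at hsq
  have hfix : τ D = D := by
    rw [hdisc, map_mul, ← sq] at hsq
    rcases sq_eq_sq_iff_eq_or_eq_neg.1 hsq with h | h
    · rw [← h]; exact τ.commutes r
    · rw [← neg_eq_iff_eq_neg.2 h, map_neg, τ.commutes]
  have h2 : (2 : E) * D = 0 := by rw [hτ] at hfix; linear_combination -hfix
  have h3 : (2 : E) = 0 := (mul_eq_zero.1 h2).resolve_right hD0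
  have h4 : (2 : K) = 0 := by
    apply (algebraMap K E).injective
    rw [map_ofNat, map_zero, h3]
  exact Ring.two_ne_zero hK h4

theorem not_isSquare_norm_derivative_minpoly (hK : ringChar K ≠ 2) (pb : PowerBasis K L)
    (hn : 4 ∣ pb.dim) :
    ¬ IsSquare (Algebra.norm K (aeval pb.gen (derivative (minpoly K pb.gen)))) := by
  have h := not_isSquare_discr_powerBasis hK pb
    (even_iff_two_dvd.2 ((by norm_num : 2 ∣ 4).trans hn))
  rw [Algebra.discr_powerBasis_eq_norm, pb.finrank] at h
  have he : Even (pb.dim * (pb.dim - 1) / 2) := by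
    obtain ⟨k, hk⟩ := hn
    rw [hk, show 4 * k * (4 * k - 1) = 2 * (2 * (k * (4 * k - 1))) by ring,
      Nat.mul_div_cancel_left _ two_pos]
    exact even_two_mul _
  rwa [he.neg_one_pow, one_mul] at h

end Stickelberger

section PolyIter

variable {R S : Type*} [CommRing R] [CommRing S]

@[simp] theorem polyIter_zero (f : R[X]) : polyIter f 0 = X := rfl

theorem polyIter_succ (f : R[X]) (n : ℕ) : polyIter f (n + 1) = f.comp (polyIter f n) := rfl

theorem polyIter_one (f : R[X]) : polyIter f 1 = f := comp_X

theorem polyIter_add (f : R[X]) (m n : ℕ) :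
    polyIter f (m + n) = (polyIter f m).comp (polyIter f n) := by
  induction m with
  | zero => simp
  | succ m ih => rw [Nat.succ_add, polyIter_succ, polyIter_succ, ih, comp_assoc]

theorem aeval_polyIter_add [Algebra R S] (f : R[X]) (x : S) (m n : ℕ) :
    aeval x (polyIter f (m + n)) = aeval (aeval x (polyIter f n)) (polyIter f m) := by
  rw [polyIter_add, aeval_comp]

theorem map_polyIter (φ : R →+* S) (f : R[X]) (n : ℕ) :
    (polyIter f n).map φ = polyIter (f.map φ) n := by
  induction n with
  | zero => simp
  | succ n ih => rw [polyIter_succ, polyIter_succ, map_comp, ih]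

theorem natDegree_polyIter [NoZeroDivisors R] (f : R[X]) (n : ℕ) [Nontrivial R] :
    (polyIter f n).natDegree = f.natDegree ^ n := by
  induction n with
  | zero => simp
  | succ n ih => rw [polyIter_succ, natDegree_comp, ih, pow_succ']

theorem leadingCoeff_polyIter_succ [NoZeroDivisors R] [Nontrivial R] (f : R[X])
    (hf : f.natDegree ≠ 0) (n : ℕ) :
    (polyIter f (n + 1)).leadingCoeff =
      f.leadingCoeff * (polyIter f n).leadingCoeff ^ f.natDegree := by
  rw [polyIter_succ, leadingCoeff_comp]
  rw [natDegree_polyIter]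
  exact pow_ne_zero _ hf

theorem derivative_polyIter (f : R[X]) (n : ℕ) :
    derivative (polyIter f n) = ∏ j ∈ Finset.range n, (derivative f).comp (polyIter f j) := by
  induction n with
  | zero => simp
  | succ n ih => rw [polyIter_succ, derivative_comp, ih, Finset.prod_range_succ]

end PolyIter

section Nonresidue

variable {K L : Type*} [Field K] [Field L] [Algebra K L]

theorem norm_algebraMap_sub_gen (pb : PowerBasis K L) (t : K) :
    Algebra.norm K (algebraMap K L t - pb.gen) = (minpoly K pb.gen).eval t := by
  rw [← charpoly_leftMulMatrix pb, Matrix.eval_charpoly, Algebra.norm_eq_matrix_det pb.basis]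
  congr 1
  rw [map_sub, AlgHom.commutes]
  rfl

theorem isSquare_norm_of_mem_intermediateField [FiniteDimensional K L] (M : IntermediateField K L)
    (hM : Even (Module.finrank M L)) (y : L) (hy : y ∈ M) : IsSquare (Algebra.norm K y) := by
  rw [← Algebra.norm_norm (S := M), show y = algebraMap M L ⟨y, hy⟩ from rfl,
    Algebra.norm_algebraMap, map_pow]
  exact hM.isSquare_pow _

theorem isSquare_mul_sq_iff {x y : K} (hy : y ≠ 0) : IsSquare (x * y ^ 2) ↔ IsSquare x := by
  constructor
  · rintro ⟨r, hr⟩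
    exact ⟨r / y, by field_simp; linear_combination hr⟩
  · rintro ⟨r, rfl⟩
    exact ⟨r * y, by ring⟩

/-- If `f' = g² (aX + b)` and `f` is dynamically irreducible over a finite field of odd
characteristic, then the critical orbit consists of nonresidues, up to the leading coefficient. -/
theorem DynIrred.not_isSquare [Finite K] (hK : ringChar K ≠ 2) {f g : K[X]} {a b : K}
    (ha : a ≠ 0) (hder : derivative f = g ^ 2 * (C a * X + C b)) (hd : Even f.natDegree)
    (hf : DynIrred f) {n : ℕ} (hn : 2 ≤ n) :
    ¬ IsSquare (f.leadingCoeff * (polyIter f n).eval (-b / a)) := by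
  have hirr := hf n (by omega)
  have hne := hirr.ne_zero
  have : Fact (Irreducible (polyIter f n)) := ⟨hirr⟩
  have hd0 : f.natDegree ≠ 0 := by
    have := (hf 1 le_rfl).natDegree_pos
    rw [polyIter_one] at this
    omega
  have hA : f.leadingCoeff ≠ 0 := by
    rw [leadingCoeff_ne_zero]; rintro rfl; simp at hd0
  let pb := AdjoinRoot.powerBasis hne
  have := pb.finite
  set D := f.natDegree ^ n with hD
  have hdim : pb.dim = D := by
    rw [hD, ← natDegree_polyIter f n]; rfl
  have h4 : 4 ∣ D := by
    obtain ⟨m, rfl⟩ := Nat.exists_eq_add_of_le hn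
    rw [hD, pow_add]
    exact Dvd.dvd.mul_right ((by norm_num : 4 = 2 ^ 2) ▸ pow_dvd_pow_of_dvd hd.two_dvd 2) _
  have hDe : Even D := even_iff_two_dvd.2 ((by norm_num : 2 ∣ 4).trans h4)
  have hst := not_isSquare_norm_derivative_minpoly hK pb (hdim ▸ h4)
  set c := (polyIter f n).leadingCoeff with hc
  have hc0 : c ≠ 0 := leadingCoeff_ne_zero.2 hne
  have hmin : minpoly K pb.gen = polyIter f n * C c⁻¹ := AdjoinRoot.minpoly_powerBasis_gen hne
  have hroot : aeval pb.gen (polyIter f n) = 0 := by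
    have := minpoly.aeval K pb.gen
    rw [hmin, map_mul, aeval_C] at this
    exact (mul_eq_zero.1 this).resolve_right (by simpa using hc0)
  have hcs : ∃ r, r ≠ 0 ∧ c = f.leadingCoeff * r ^ 2 := by
    obtain ⟨m, rfl⟩ : ∃ m, n = m + 1 := ⟨n - 1, by omega⟩
    obtain ⟨k, hk⟩ := hd
    refine ⟨(polyIter f m).leadingCoeff ^ k, pow_ne_zero _ ?_, ?_⟩
    · exact leadingCoeff_ne_zero.2 (hf m (by omega)).ne_zero
    · rw [hc, leadingCoeff_polyIter_succ f hd0, hk]; ring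
  obtain ⟨r, hr0, hr⟩ := hcs
  intro hsq
  apply hst
  rw [hmin, derivative_mul, derivative_C, mul_zero, add_zero, derivative_polyIter, map_mul,
    map_mul, aeval_C, Algebra.norm_algebraMap, pb.finrank, hdim, map_prod, map_prod]
  refine IsSquare.mul ?_ (hDe.isSquare_pow _)
  refine Finset.isSquare_prod _ fun j hj => ?_
  rw [Finset.mem_range] at hj
  rw [hder, aeval_comp, map_mul, map_mul, map_pow, map_pow]
  refine IsSquare.mul (even_two.isSquare_pow _) ?_
  simp only [map_add, map_mul, aeval_C, aeval_X]
  rcases Nat.eq_zero_or_pos j with rfl | hj0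
  · simp only [polyIter_zero, aeval_X]
    have h1 : algebraMap K (AdjoinRoot (polyIter f n)) a * pb.gen + algebraMap K _ b =
        algebraMap K _ (-a) * (algebraMap K _ (-b / a) - pb.gen) := by
      rw [mul_sub, ← map_mul, show -a * (-b / a) = b by field_simp, map_neg]
      ring
    rw [h1, map_mul, Algebra.norm_algebraMap, pb.finrank, hdim, norm_algebraMap_sub_gen, hmin]
    refine IsSquare.mul (hDe.isSquare_pow _) ?_
    rw [eval_mul, eval_C, hr, ← isSquare_mul_sq_iff (mul_ne_zero hA hr0)]
    convert hsq using 1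
    field_simp
  · set x := aeval pb.gen (polyIter f j) with hx
    have hxint : IsIntegral K x := IsIntegral.of_finite K x
    have hjn := hf (n - j) (by omega)
    have hxr : aeval x (polyIter f (n - j)) = 0 := by
      rw [hx, ← aeval_polyIter_add, Nat.sub_add_cancel hj.le, hroot]
    have hdeg : Module.finrank K (IntermediateField.adjoin K {x}) = f.natDegree ^ (n - j) := by
      rw [IntermediateField.adjoin.finrank hxint, ← natDegree_polyIter,
        ← minpoly.eq_of_irreducible hjn hxr, natDegree_mul_C]
      simpa using hjn.ne_zero
    have hmul := Module.finrank_mul_finrank K (IntermediateField.adjoin K {x})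
      (AdjoinRoot (polyIter f n))
    have hj' : Even (f.natDegree ^ j) := hd.pow_of_ne_zero hj0.ne'
    have hdn : D = f.natDegree ^ (n - j) * f.natDegree ^ j := by
      rw [hD, ← pow_add, Nat.sub_add_cancel hj.le]
    rw [hdeg, pb.finrank, hdim, hdn] at hmul
    have := Nat.eq_of_mul_eq_mul_left (by positivity) hmul
    apply isSquare_norm_of_mem_intermediateField (IntermediateField.adjoin K {x}) (this ▸ hj')
    exact add_mem (mul_mem (algebraMap_mem _ a) (IntermediateField.mem_adjoin_simple_self K x))
      (algebraMap_mem _ b)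

end Nonresidue

section CriticalOrbit

/-- The integer `a ^ (d ^ n) * f^(n)(-b / a)`. -/
noncomputable def homIter (f : ℤ[X]) (a b : ℤ) (n : ℕ) : ℤ :=
  ((polyIter f n).scaleRoots a).eval (-b)

theorem map_homIter {K : Type*} [Field K] (φ : ℤ →+* K) (f : ℤ[X]) {a : ℤ} (b : ℤ)
    (ha : φ a ≠ 0) (n : ℕ) :
    φ (homIter f a b n) =
      φ a ^ f.natDegree ^ n * (polyIter (f.map φ) n).eval (-φ b / φ a) := by
  have h := scaleRoots_eval₂_mul (p := polyIter f n) φ (-φ b / φ a) a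
  rw [mul_div_cancel₀ _ ha, natDegree_polyIter] at h
  rw [← map_polyIter, eval_map, ← h, homIter, ← map_neg, eval₂_at_apply]

theorem cast_homIter (f : ℤ[X]) {a : ℤ} (b : ℤ) (ha : a ≠ 0) (n : ℕ) :
    (homIter f a b n : ℚ) =
      (a : ℚ) ^ f.natDegree ^ n * aeval (-(b : ℚ) / a) (polyIter f n) := by
  have := map_homIter (Int.castRingHom ℚ) f b (by simpa using ha) n
  rw [← map_polyIter, eval_map] at this
  simpa [aeval_def] using this

theorem oddJacobi_homIter {f g : ℤ[X]} {a b : ℤ} (hder : derivative f = g ^ 2 * (C a * X + C b))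
    (hd : Even f.natDegree) {p : ℕ} (hp : p.Prime) (hp2 : p ≠ 2) (hpa : ¬ (p : ℤ) ∣ a)
    (hpA : ¬ (p : ℤ) ∣ f.leadingCoeff)
    (hf : DynIrred (f.map (Int.castRingHom (ZMod p)))) {n : ℕ} (hn : 2 ≤ n) :
    oddJacobi (f.leadingCoeff * homIter f a b n) p = -1 := by
  have : Fact p.Prime := ⟨hp⟩
  rw [oddJacobi, if_pos (hp.odd_of_ne_two hp2), ← jacobiSym.legendreSym.to_jacobiSym,
    legendreSym.eq_neg_one_iff]
  set φ := Int.castRingHom (ZMod p)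
  have ha' : φ a ≠ 0 := by rwa [eq_intCast, Ne, ZMod.intCast_zmod_eq_zero_iff_dvd]
  have hA' : φ f.leadingCoeff ≠ 0 := by rwa [eq_intCast, Ne, ZMod.intCast_zmod_eq_zero_iff_dvd]
  have hder' : derivative (f.map φ) = (g.map φ) ^ 2 * (C (φ a) * X + C (φ b)) := by
    rw [derivative_map, hder]; simp
  have hdeg : (f.map φ).natDegree = f.natDegree := natDegree_map_of_leadingCoeff_ne_zero φ hA'
  have hlc : (f.map φ).leadingCoeff = φ f.leadingCoeff :=
    leadingCoeff_map_of_leadingCoeff_ne_zero φ hA'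
  have h := hf.not_isSquare (by rw [ZMod.ringChar_zmod_n]; exact hp2) ha' hder' (hdeg ▸ hd) hn
  rw [hlc] at h
  have he : Even (f.natDegree ^ n) := hd.pow_of_ne_zero (by omega)
  obtain ⟨k, hk⟩ := he
  rw [← eq_intCast φ, map_mul, map_homIter φ f b ha', hk, ← mul_assoc, mul_right_comm, ← two_mul,
    mul_comm 2 k, pow_mul, isSquare_mul_sq_iff (pow_ne_zero _ ha')]
  exact h

end CriticalOrbit

section Place

open Filter Topology Bornology

variable {L : Type*} [NormedField L]

theorem tendsto_eval_div_pow {α : Type*} {l : Filter α} {x : α → L}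
    (hx : Tendsto x l (cobounded L)) {P : L[X]} {m : ℕ} (hP : P.natDegree ≤ m) :
    Tendsto (fun n => P.eval (x n) / x n ^ m) l (𝓝 (P.coeff m)) := by
  have hinv : Tendsto (fun n => (x n)⁻¹) l (𝓝 0) := tendsto_inv₀_cobounded.comp hx
  have hne : ∀ᶠ n in l, x n ≠ 0 := hx.eventually (eventually_ne_cobounded 0)
  have h : Tendsto (fun n => ∑ i ∈ Finset.range (m + 1), P.coeff i * (x n)⁻¹ ^ (m - i)) l
      (𝓝 (∑ i ∈ Finset.range (m + 1), P.coeff i * (0 : L) ^ (m - i))) :=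
    tendsto_finsetSum _ fun i _ => (hinv.pow _).const_mul _
  have hlim : ∑ i ∈ Finset.range (m + 1), P.coeff i * (0 : L) ^ (m - i) = P.coeff m := by
    rw [Finset.sum_range_succ, Finset.sum_eq_zero, zero_add, Nat.sub_self, pow_zero, mul_one]
    intro i hi
    rw [zero_pow, mul_zero]
    have := Finset.mem_range.1 hi
    omega
  rw [hlim] at h
  refine h.congr' (hne.mono fun n hn => ?_)
  simp only [eval_eq_sum_range' (Nat.lt_succ_of_le hP), Finset.sum_div]
  refine Finset.sum_congr rfl fun i hi => ?_
  have := Finset.mem_range.1 hi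
  rw [mul_div_assoc, inv_pow, pow_sub₀ _ hn (by omega), mul_inv, inv_inv, mul_comm (x n ^ m)⁻¹,
    div_eq_mul_inv]

theorem exists_escape_radius {F : L[X]} (hF : 2 ≤ F.natDegree) :
    ∃ B : ℝ, 0 < B ∧ ∀ x : L, B < ‖x‖ → 2 * ‖x‖ ≤ ‖F.eval x‖ := by
  have hd : 0 < F.divX.degree := by
    rw [← natDegree_pos_iff_degree_pos, natDegree_divX_eq_natDegree_tsub_one]
    omega
  have h := F.divX.tendsto_norm_atTop hd (l := comap (fun x : L => ‖x‖) atTop)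
    tendsto_comap
  have h3 := h.eventually_ge_atTop 3
  rw [eventually_comap] at h3
  obtain ⟨B, hB⟩ := eventually_atTop.1 h3
  refine ⟨max (max B 1) ‖F.coeff 0‖, by positivity, fun x hx => ?_⟩
  have h1 := hB ‖x‖ (by exact ((le_max_left _ _).trans (le_max_left _ _)).trans hx.le) x rfl
  have h2 : ‖F.coeff 0‖ ≤ ‖x‖ := (le_max_right _ _).trans hx.le
  conv_rhs => rw [← F.divX_mul_X_add]
  rw [eval_add, eval_mul, eval_X, eval_C]
  have h4 := norm_sub_le_norm_add (eval x F.divX * x) (F.coeff 0)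
  rw [norm_mul] at h4
  nlinarith [norm_nonneg x]

theorem tendsto_cobounded_or_bounded {F : L[X]} (hF : 2 ≤ F.natDegree) {x : ℕ → L}
    (hx : ∀ n, x (n + 1) = F.eval (x n)) :
    Tendsto x atTop (cobounded L) ∨ ∃ B : ℝ, ∀ n, ‖x n‖ ≤ B := by
  obtain ⟨B, hB0, hB⟩ := exists_escape_radius hF
  by_cases h : ∀ n, ‖x n‖ ≤ B
  · exact Or.inr ⟨B, h⟩
  left
  push Not at h
  obtain ⟨N, hN⟩ := h
  have key : ∀ n, B < ‖x (n + N)‖ ∧ 2 ^ n * B ≤ ‖x (n + N)‖ := by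
    intro n
    induction n with
    | zero => simpa using ⟨hN, hN.le⟩
    | succ n ih =>
      have h1 := hB _ ih.1
      rw [← hx, show n + N + 1 = n + 1 + N by ring] at h1
      constructor
      · linarith [ih.1]
      · rw [pow_succ]; linarith [ih.2]
  rw [← tendsto_norm_atTop_iff_cobounded, ← tendsto_add_atTop_iff_nat N]
  refine tendsto_atTop_mono (fun n => (key n).2) ?_
  exact (tendsto_pow_atTop_atTop_of_one_lt one_lt_two).atTop_mul_const hB0

theorem tendsto_mul_one_of_sq {α : Type*} {l : Filter α} {z z' : α → L}
    (hz : Tendsto (fun n => z n ^ 2) l (𝓝 1)) (hz' : Tendsto (fun n => z' n ^ 2) l (𝓝 1))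
    (h : ∀ᶠ n in l, ‖z n - 1‖ ≤ ‖z n + 1‖ ↔ ‖z' n - 1‖ ≤ ‖z' n + 1‖) :
    Tendsto (fun n => z n * z' n) l (𝓝 1) := by
  classical
  let ε : α → L := fun n => if ‖z n - 1‖ ≤ ‖z n + 1‖ then 1 else -1
  let ε' : α → L := fun n => if ‖z' n - 1‖ ≤ ‖z' n + 1‖ then 1 else -1
  have aux : ∀ z : α → L, Tendsto (fun n => z n ^ 2) l (𝓝 1) →
      Tendsto (fun n => (if ‖z n - 1‖ ≤ ‖z n + 1‖ then 1 else -1) * z n) l (𝓝 1) := by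
    intro z hz
    rw [tendsto_iff_norm_sub_tendsto_zero] at hz ⊢
    have h1 : Tendsto (fun n => √‖z n ^ 2 - 1‖) l (𝓝 0) := by
      simpa using hz.sqrt
    refine squeeze_zero (fun _ => norm_nonneg _) (fun n => ?_) h1
    apply Real.le_sqrt_of_sq_le
    rw [show z n ^ 2 - 1 = (z n - 1) * (z n + 1) by ring, norm_mul]
    split_ifs with hs
    · rw [one_mul, sq]
      exact mul_le_mul_of_nonneg_left hs (norm_nonneg _)
    · rw [show -1 * z n - 1 = -(z n + 1) by ring, norm_neg, sq]
      exact mul_le_mul_of_nonneg_right (not_le.1 hs).le (norm_nonneg _)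
  have := (aux z hz).mul (aux z' hz')
  rw [one_mul] at this
  refine this.congr' (h.mono fun n hn => ?_)
  simp only [hn]
  split_ifs <;> ring

theorem tendsto_sub_of_sq_eq [CharZero L] {F H : L[X]} {h k : ℕ} (hd : F.natDegree = 2 * h)
    (hh : h ≠ 0) {x : ℕ → L} (hx : ∀ n, x (n + 1) = F.eval (x n))
    (hxt : Tendsto x atTop (cobounded L)) {l : Filter ℕ} (hl : l ≤ atTop) {η η' : ℕ → L}
    (hη : ∀ᶠ n in l, η n ^ 2 = F.leadingCoeff * x (n + 1))
    (hη' : ∀ᶠ n in l, η' n ^ 2 = F.leadingCoeff * x (n + k + 1))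
    (hs : ∀ᶠ n in l, ‖η n / (F.leadingCoeff * x n ^ h) - 1‖ ≤
        ‖η n / (F.leadingCoeff * x n ^ h) + 1‖ ↔
      ‖η' n / (F.leadingCoeff * x (n + k) ^ h) - 1‖ ≤
        ‖η' n / (F.leadingCoeff * x (n + k) ^ h) + 1‖)
    (hH : H.natDegree ≤ h + (2 * h) ^ k * h)
    (hHc : H.coeff (h + (2 * h) ^ k * h) =
      F.leadingCoeff ^ 2 * (polyIter F k).leadingCoeff ^ h)
    (hR : (C (F.leadingCoeff ^ 2) * F * polyIter F (k + 1) - H ^ 2).degree <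
      ((h + (2 * h) ^ k * h : ℕ) : WithBot ℕ)) :
    Tendsto (fun n => η n * η' n - H.eval (x n)) l (𝓝 0) := by
  set A := F.leadingCoeff with hA
  set m := h + (2 * h) ^ k * h with hm
  have hA0 : A ≠ 0 := by
    rw [hA, leadingCoeff_ne_zero]; rintro rfl; simp at hd; omega
  have hiter : ∀ n k, x (n + k) = (polyIter F k).eval (x n) := by
    intro n k
    induction k with
    | zero => simp
    | succ k ih => rw [← add_assoc, hx, ih, polyIter_succ, eval_comp]
  have hdk : (polyIter F k).natDegree = (2 * h) ^ k := by rw [natDegree_polyIter, hd]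
  have hxl : Tendsto x l (cobounded L) := hxt.mono_left hl
  have hne : ∀ᶠ n in l, x n ≠ 0 := hxl.eventually (eventually_ne_cobounded 0)
  have hxk : Tendsto (fun n => x (n + k)) l (cobounded L) :=
    (hxt.comp (tendsto_add_atTop_nat k)).mono_left hl
  have hnek : ∀ᶠ n in l, x (n + k) ≠ 0 := hxk.eventually (eventually_ne_cobounded 0)
  have hz : Tendsto (fun n => (η n / (A * x n ^ h)) ^ 2) l (𝓝 1) := by
    have h1 := (tendsto_eval_div_pow hxl hd.le).const_mul A⁻¹
    rw [← hd, coeff_natDegree, inv_mul_cancel₀ hA0] at h1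
    refine h1.congr' ?_
    filter_upwards [hη, hne] with n h1 h2
    rw [div_pow, h1, hx, hd]
    field_simp
    ring
  have hz' : Tendsto (fun n => (η' n / (A * x (n + k) ^ h)) ^ 2) l (𝓝 1) := by
    have h1 := (tendsto_eval_div_pow hxk hd.le).const_mul A⁻¹
    rw [← hd, coeff_natDegree, inv_mul_cancel₀ hA0] at h1
    refine h1.congr' ?_
    filter_upwards [hη', hnek] with n h1 h2
    rw [div_pow, h1, hx, hd]
    field_simp
    ring
  have hzz := tendsto_mul_one_of_sq hz hz' hs
  have hk := tendsto_eval_div_pow hxl hdk.le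
  rw [← hdk, coeff_natDegree] at hk
  set Ak := (polyIter F k).leadingCoeff with hAk
  have hAk0 : Ak ≠ 0 := by
    rw [hAk, leadingCoeff_ne_zero]
    intro h0
    rw [h0, natDegree_zero] at hdk
    exact absurd hdk.symm (pow_ne_zero _ (by omega))
  have hy : Tendsto (fun n => η n * η' n / x n ^ m) l (𝓝 (A ^ 2 * Ak ^ h)) := by
    have h1 := ((hk.pow h).const_mul (A ^ 2)).mul hzz
    rw [mul_one] at h1
    refine h1.congr' ?_
    filter_upwards [hne, hnek] with n h1 h2
    rw [← hiter, hdk, hm, pow_add, pow_mul, div_pow]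
    field_simp
  have hsum := hy.add (tendsto_eval_div_pow hxl hH)
  rw [hHc] at hsum
  have hc : A ^ 2 * Ak ^ h + A ^ 2 * Ak ^ h ≠ 0 := by
    rw [← two_mul]
    exact mul_ne_zero two_ne_zero (mul_ne_zero (pow_ne_zero _ hA0) (pow_ne_zero _ hAk0))
  have hR' := tendsto_eval_div_pow hxl (natDegree_le_of_degree_le hR.le)
  rw [coeff_eq_zero_of_degree_lt hR] at hR'
  have := hR'.div hsum hc
  rw [zero_div] at this
  refine this.congr' ?_
  filter_upwards [hne, hη, hη', hsum.eventually_ne hc] with n h1 h2 h3 h4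
  have h5 : (C (A ^ 2) * F * polyIter F (k + 1) - H ^ 2).eval (x n) =
      (η n * η' n) ^ 2 - (H.eval (x n)) ^ 2 := by
    rw [mul_pow, h2, h3, hx, add_assoc n k 1, hiter n (k + 1)]
    simp
    ring
  simp only [Pi.div_apply, h5]
  have h6 : η n * η' n + H.eval (x n) ≠ 0 := by
    intro h0
    rw [← add_div, h0, zero_div] at h4
    exact h4 rfl
  rw [← add_div]
  field_simp
  ring

end Place

section SquareRootPart

theorem exists_degree_sub_sq_lt {K : Type*} [Field K] [CharZero K] {T : K[X]} {m : ℕ} {c : K}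
    (hc : c ≠ 0) (hT : T.natDegree ≤ 2 * m) (hTc : T.coeff (2 * m) = c ^ 2) :
    ∃ H : K[X], H.natDegree ≤ m ∧ H.coeff m = c ∧ (T - H ^ 2).degree < (m : WithBot ℕ) := by
  suffices h : ∀ j ≤ m, ∃ H : K[X], H.natDegree ≤ m ∧ H.coeff m = c ∧
      (T - H ^ 2).degree < ((2 * m - j : ℕ) : WithBot ℕ) by
    have := h m le_rfl
    rwa [show 2 * m - m = m by omega] at this
  intro j
  induction j with
  | zero =>
    refine fun _ => ⟨C c * X ^ m, natDegree_C_mul_X_pow_le _ _, by simp, ?_⟩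
    rw [degree_lt_iff_coeff_zero]
    intro s hs
    rw [mul_pow, ← C_pow, ← pow_mul, coeff_sub, coeff_C_mul, coeff_X_pow, mul_comm m 2]
    rcases hs.eq_or_lt with rfl | hs
    · simp [hTc]
    · rw [if_neg (by omega), coeff_eq_zero_of_natDegree_lt (by omega)]; simp
  | succ j ih =>
    intro hj
    obtain ⟨H, hH, hHc, hR⟩ := ih (by omega)
    obtain ⟨r, rfl⟩ : ∃ r, m = j + 1 + r := ⟨m - (j + 1), by omega⟩
    set m := j + 1 + r with hm
    set t := (T - H ^ 2).coeff (m + r) / (2 * c) with ht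
    refine ⟨H + C t * X ^ r, ?_, ?_, ?_⟩
    · refine (natDegree_add_le _ _).trans (max_le hH ((natDegree_C_mul_X_pow_le _ _).trans ?_))
      omega
    · rw [coeff_add, hHc, coeff_C_mul, coeff_X_pow, if_neg (by omega)]; simp
    · rw [degree_lt_iff_coeff_zero] at hR ⊢
      intro s hs
      have h1 : T - (H + C t * X ^ r) ^ 2 =
          (T - H ^ 2) - C (2 * t) * (H * X ^ r) - C (t ^ 2) * X ^ (2 * r) := by
        rw [C_mul, C_pow]
        simp only [map_ofNat]
        ring
      obtain ⟨s, rfl⟩ : ∃ s', s = s' + r := ⟨s - r, by omega⟩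
      rw [h1, coeff_sub, coeff_sub, coeff_C_mul, coeff_C_mul, coeff_X_pow, if_neg (by omega),
        coeff_mul_X_pow, mul_zero, sub_zero]
      rcases eq_or_ne s m with rfl | hsm
      · rw [hHc, ht]; field_simp; ring
      · rw [hR _ (by omega), coeff_eq_zero_of_natDegree_lt (by omega)]; simp

theorem not_isSquare_mul_of_derivative {K : Type*} [Field K] [CharZero K] [IsAlgClosed K]
    {F g G : K[X]} {a b : K} (ha : a ≠ 0) (hder : derivative F = g ^ 2 * (C a * X + C b))
    (hF : F.natDegree ≠ 0) (hγ : F.eval (-b / a) ≠ 0)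
    (hG : ∀ θ, F.eval θ = 0 → G.eval θ ≠ 0) : ¬ IsSquare (F * G) := by
  rintro ⟨P, hP⟩
  obtain ⟨θ, hθ⟩ := IsAlgClosed.exists_root F (by
    intro h; exact hF (natDegree_eq_of_degree_eq_some h))
  have hF0 : F ≠ 0 := by rintro rfl; simp at hF
  have hG0 : G ≠ 0 := by rintro rfl; exact hG θ hθ (by simp)
  have hd0 : derivative F ≠ 0 := by
    intro h
    exact hF (derivative_eq_zero.1 h)
  have hFG : F * G ≠ 0 := mul_ne_zero hF0 hG0
  have h1 := congrArg (rootMultiplicity θ) hP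
  rw [rootMultiplicity_mul hFG, rootMultiplicity_mul (hP ▸ hFG),
    rootMultiplicity_eq_zero (p := G) (hG θ hθ)] at h1
  have h2 := derivative_rootMultiplicity_of_root hθ
  have h3 : 0 < F.rootMultiplicity θ := (rootMultiplicity_pos hF0).2 hθ
  rw [hder] at hd0 h2
  have hg := left_ne_zero_of_mul hd0
  rw [rootMultiplicity_mul hd0, pow_two, rootMultiplicity_mul (pow_two g ▸ hg),
    rootMultiplicity_eq_zero (p := C a * X + C b)] at h2
  · omega
  · intro h
    apply hγ
    have : θ = -b / a := by
      rw [eq_div_iff ha]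
      simp at h
      linear_combination h
    rw [← this]
    exact hθ

theorem natDegree_even_of_derivative {f g : ℤ[X]} {a b : ℤ} (hdeg : 2 ≤ f.natDegree)
    (ha : a ≠ 0) (hder : derivative f = g ^ 2 * (C a * X + C b)) : Even f.natDegree := by
  have h1 := congrArg natDegree hder
  have h2 : derivative f ≠ 0 := by
    intro h
    have := derivative_eq_zero.1 h
    omega
  rw [hder] at h2
  rw [natDegree_derivative, natDegree_mul (left_ne_zero_of_mul h2) (right_ne_zero_of_mul h2),
    natDegree_pow, natDegree_linear ha] at h1
  exact ⟨g.natDegree + 1, by omega⟩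

end SquareRootPart

section Places

open Finset

theorem padicNorm_natCast_eq {p n : ℕ} [Fact p.Prime] (hn : n ≠ 0) :
    padicNorm p n = ((p ^ n.factorization p : ℕ) : ℚ)⁻¹ := by
  have hp : p.Prime := Fact.out
  rw [padicNorm.eq_zpow_of_nonzero (by exact_mod_cast hn), padicValRat.of_nat,
    Nat.factorization_def n hp, zpow_neg, zpow_natCast, Nat.cast_pow]

theorem padicNorm_eq_div (p : ℕ) [Fact p.Prime] (q : ℚ) :
    padicNorm p q = padicNorm p (q.num.natAbs : ℚ) / padicNorm p (q.den : ℚ) := by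
  conv_lhs => rw [← Rat.num_div_den q]
  rw [padicNorm.div]
  congr 1
  rcases Int.natAbs_eq q.num with h | h
  · conv_lhs => rw [h, Int.cast_natCast]
  · conv_lhs => rw [h, Int.cast_neg, Int.cast_natCast, padicNorm.neg]

theorem padicNorm_eq_of_dvd_den {p : ℕ} [hp : Fact p.Prime] {q : ℚ} (h : p ∣ q.den) :
    padicNorm p q = (p ^ q.den.factorization p : ℕ) := by
  have h1 : ¬ p ∣ q.num.natAbs := fun h' =>
    Nat.not_coprime_of_dvd_of_dvd hp.out.one_lt h' h q.reduced
  rw [padicNorm_eq_div, (padicNorm.nat_eq_one_iff _).2 h1, padicNorm_natCast_eq q.den_ne_zero,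
    one_div, inv_inv]

theorem primeFactors_den_subset {S : Finset ℕ} {q : ℚ}
    (hq : ∀ p : ℕ, p.Prime → p ∉ S → padicNorm p q ≤ 1) : q.den.primeFactors ⊆ S := by
  intro p hp
  by_contra hpS
  have hpp := Nat.prime_of_mem_primeFactors hp
  have : Fact p.Prime := ⟨hpp⟩
  have h := hq p hpp hpS
  have hdvd := Nat.dvd_of_mem_primeFactors hp
  rw [padicNorm_eq_of_dvd_den hdvd] at h
  have h1 : 1 < p ^ q.den.factorization p :=
    Nat.one_lt_pow (hpp.factorization_pos_of_dvd q.den_ne_zero hdvd).ne' hpp.one_lt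
  have h2 : p ^ q.den.factorization p ≤ 1 := by exact_mod_cast h
  omega

theorem eq_prod_pow_factorization {n : ℕ} (hn : n ≠ 0) {S : Finset ℕ} (hS : n.primeFactors ⊆ S) :
    n = ∏ p ∈ S, p ^ n.factorization p := by
  conv_lhs => rw [← Nat.prod_factorization_pow_eq_self hn]
  exact Finsupp.prod_of_support_subset _ hS _ (by simp)

theorem prod_pow_factorization_le {n : ℕ} (hn : n ≠ 0) {S : Finset ℕ}
    (hS : ∀ p ∈ S, p.Prime) : ∏ p ∈ S, p ^ n.factorization p ≤ n := by
  conv_rhs => rw [eq_prod_pow_factorization hn (subset_union_right (s₁ := S))]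
  refine prod_le_prod_of_subset_of_one_le' subset_union_left fun p hp _ => ?_
  refine Nat.one_le_pow _ _ ?_
  rcases mem_union.1 hp with h | h
  · exact (hS p h).pos
  · exact Nat.pos_of_mem_primeFactors h

/-- The absolute values on `ℚ`, indexed by `0` (the archimedean one) and the primes. -/
noncomputable def ratPlace (i : ℕ) (q : ℚ) : ℝ := if i = 0 then |(q : ℝ)| else padicNorm i q

theorem ratPlace_zero (q : ℚ) : ratPlace 0 q = |(q : ℝ)| := if_pos rfl

theorem ratPlace_prime {p : ℕ} (hp : p.Prime) (q : ℚ) : ratPlace p q = padicNorm p q :=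
  if_neg hp.ne_zero

theorem one_le_prod_ratPlace {S : Finset ℕ} (hS : ∀ p ∈ S, p.Prime) {q : ℚ} (hq0 : q ≠ 0)
    (hq : ∀ p : ℕ, p.Prime → p ∉ S → padicNorm p q ≤ 1) :
    1 ≤ ∏ i ∈ insert 0 S, ratPlace i q := by
  have h0 : 0 ∉ S := fun h => Nat.not_prime_zero (hS 0 h)
  have hnum : q.num.natAbs ≠ 0 := by simpa using hq0
  rw [prod_insert h0, ratPlace_zero, prod_congr rfl fun p hp => ratPlace_prime (hS p hp) q]
  suffices h : 1 ≤ |q| * ∏ p ∈ S, padicNorm p q by exact_mod_cast h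
  have h1 : ∏ p ∈ S, padicNorm p q =
      ((∏ p ∈ S, p ^ q.num.natAbs.factorization p : ℕ) : ℚ)⁻¹ * q.den := by
    conv_rhs => rw [eq_prod_pow_factorization q.den_ne_zero (primeFactors_den_subset hq)]
    rw [Nat.cast_prod, Nat.cast_prod, ← prod_inv_distrib, ← prod_mul_distrib]
    refine prod_congr rfl fun p hp => ?_
    have : Fact p.Prime := ⟨hS p hp⟩
    rw [padicNorm_eq_div, padicNorm_natCast_eq hnum, padicNorm_natCast_eq q.den_ne_zero,
      div_inv_eq_mul]
  have h2 : |q| = q.num.natAbs / q.den := by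
    conv_lhs => rw [← Rat.num_div_den q]
    rw [abs_div, Nat.abs_cast, Nat.cast_natAbs, Int.cast_abs]
  have h3 := prod_pow_factorization_le hnum hS
  have h4 : 0 < ∏ p ∈ S, p ^ q.num.natAbs.factorization p :=
    prod_pos fun p hp => pow_pos (hS p hp).pos _
  have h5 : (0 : ℚ) < q.den := by exact_mod_cast q.den_pos
  rw [h1, h2, show (q.num.natAbs : ℚ) / q.den *
    (((∏ p ∈ S, p ^ q.num.natAbs.factorization p : ℕ) : ℚ)⁻¹ * q.den) =
      q.num.natAbs / ((∏ p ∈ S, p ^ q.num.natAbs.factorization p : ℕ) : ℚ) by field_simp,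
    one_le_div (by exact_mod_cast h4)]
  exact_mod_cast h3

theorem finite_setOf_ratPlace_le {S : Finset ℕ} (hS : ∀ p ∈ S, p.Prime) (B : ℝ) :
    {q : ℚ | (∀ p : ℕ, p.Prime → p ∉ S → padicNorm p q ≤ 1) ∧
      ∀ i ∈ insert 0 S, ratPlace i q ≤ B}.Finite := by
  set N := (⌈|B|⌉₊ + 1) ^ #S with hN
  set M := ⌈|B|⌉₊ * N with hM
  refine ((Set.finite_Icc (-(M : ℤ)) M).prod (Set.finite_Iic N)).image
    (fun x => (x.1 : ℚ) / x.2) |>.subset ?_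
  rintro q ⟨hq, hB⟩
  have hden : q.den ≤ N := by
    rw [eq_prod_pow_factorization q.den_ne_zero (primeFactors_den_subset hq), hN]
    refine prod_le_pow_card _ _ _ fun p hp => ?_
    have : Fact p.Prime := ⟨hS p hp⟩
    by_cases h : p ∣ q.den
    · have h1 := hB p (mem_insert_of_mem hp)
      rw [ratPlace_prime (hS p hp), padicNorm_eq_of_dvd_den h, Rat.cast_natCast] at h1
      have h2 := h1.trans ((le_abs_self B).trans (Nat.le_ceil _))
      exact (Nat.cast_le.1 h2).trans (Nat.le_succ _)
    · rw [Nat.factorization_eq_zero_of_not_dvd h, pow_zero]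
      omega
  have hnum : q.num.natAbs ≤ M := by
    have h1 := hB 0 (mem_insert_self _ _)
    rw [ratPlace_zero] at h1
    have h2 : |(q : ℝ)| = q.num.natAbs / q.den := by
      conv_lhs => rw [Rat.cast_def]
      rw [abs_div, Nat.abs_cast, Nat.cast_natAbs, Int.cast_abs]
    have h3 := h1.trans ((le_abs_self B).trans (Nat.le_ceil _))
    rw [h2, div_le_iff₀ (by exact_mod_cast q.den_pos)] at h3
    have h4 : q.num.natAbs ≤ ⌈|B|⌉₊ * q.den := by exact_mod_cast h3
    exact h4.trans (Nat.mul_le_mul_left _ hden)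
  refine ⟨(q.num, q.den), ⟨?_, hden⟩, Rat.num_div_den q⟩
  simp only [Set.mem_Icc]
  omega

theorem exists_normedField_ratPlace {S : Finset ℕ} (hS : ∀ p ∈ S, p.Prime) {i : ℕ}
    (hi : i ∈ insert 0 S) :
    ∃ (L : Type) (_ : NormedField L) (_ : CharZero L) (_ : IsAlgClosed L),
      ∀ q : ℚ, ratPlace i q = ‖(q : L)‖ := by
  rcases mem_insert.1 hi with rfl | hi
  · exact ⟨ℂ, inferInstance, inferInstance, inferInstance, fun q => by
      rw [ratPlace_zero, Complex.norm_ratCast]⟩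
  · have hp := hS i hi
    have : Fact i.Prime := ⟨hp⟩
    refine ⟨PadicAlgCl i, inferInstance, inferInstance, inferInstance, fun q => ?_⟩
    rw [ratPlace_prime hp, ← Padic.eq_padicNorm, ← PadicAlgCl.norm_extends, map_ratCast]

end Places

section Orbit

variable {f : ℤ[X]} {γ : ℚ}

theorem injective_orbit (hγ : ¬ IsPreperiodicPt f γ) :
    Function.Injective fun n => aeval γ (polyIter f n) := by
  intro i j hij
  by_contra hne
  wlog hlt : i < j generalizing i j
  · exact this hij.symm (Ne.symm hne) (by omega)
  apply hγ
  have key : ∀ n, ∃ m < j, aeval γ (polyIter f n) = aeval γ (polyIter f m) := by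
    intro n
    induction n using Nat.strong_induction_on with
    | _ n ih =>
      by_cases hn : n < j
      · exact ⟨n, hn, rfl⟩
      obtain ⟨m, hm, h⟩ := ih (n - j + i) (by omega)
      refine ⟨m, hm, ?_⟩
      rw [← h, aeval_polyIter_add]
      conv_lhs => rw [← Nat.sub_add_cancel (not_lt.1 hn), aeval_polyIter_add]
      exact congrArg (fun x => aeval x (polyIter f (n - j))) hij.symm
  refine ((Set.finite_Iio j).image fun m => aeval γ (polyIter f m)).subset ?_
  rintro x ⟨n, -, rfl⟩
  obtain ⟨m, hm, h⟩ := key n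
  exact ⟨m, hm, h.symm⟩

theorem orbit_ne_zero (h0 : IsPreperiodicPt f 0) (hγ : ¬ IsPreperiodicPt f γ) (n : ℕ) :
    aeval γ (polyIter f n) ≠ 0 := by
  intro h
  refine Set.infinite_of_injective_forall_mem
    ((injective_orbit hγ).comp (add_left_injective (n + 1))) (fun k => ?_) h0
  refine ⟨k + 1, by omega, ?_⟩
  simp only [Function.comp_apply]
  rw [show k + (n + 1) = k + 1 + n by ring, aeval_polyIter_add, h]

theorem padicNorm_aeval_le_one {p : ℕ} [Fact p.Prime] {x : ℚ} (hx : padicNorm p x ≤ 1)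
    (P : ℤ[X]) : padicNorm p (aeval x P) ≤ 1 := by
  induction P using Polynomial.induction_on with
  | C c => simpa using padicNorm.of_int (p := p) c
  | add P Q hP hQ =>
    rw [map_add]
    exact padicNorm.nonarchimedean.trans (max_le hP hQ)
  | monomial n c h =>
    rw [pow_succ, ← mul_assoc, map_mul, aeval_X, padicNorm.mul]
    exact mul_le_one₀ h (padicNorm.nonneg _) hx

end Orbit

section PlaceDichotomy

open Filter Topology Bornology

theorem exists_sign_of_place {ν : ℚ → ℝ}
    (hν : ∃ (L : Type) (_ : NormedField L) (_ : CharZero L) (_ : IsAlgClosed L),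
      ∀ q : ℚ, ν q = ‖(q : L)‖) {F : ℚ[X]} {h : ℕ} (hd : F.natDegree = 2 * h) (hh : h ≠ 0)
    {u : ℕ → ℚ} (hu : ∀ n, u (n + 1) = F.eval (u n)) :
    ∃ σ : ℚ → ℕ → ℚ → Prop, ∀ (k : ℕ) (e : ℚ) (H : ℚ[X]),
      H.natDegree ≤ h + (2 * h) ^ k * h →
      H.coeff (h + (2 * h) ^ k * h) = F.leadingCoeff ^ 2 * (polyIter F k).leadingCoeff ^ h →
      (C (F.leadingCoeff ^ 2) * F * polyIter F (k + 1) - H ^ 2).degree <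
        ((h + (2 * h) ^ k * h : ℕ) : WithBot ℕ) →
      ∀ l : Filter ℕ, l ≤ atTop → ∀ y y' : ℕ → ℚ,
      (∀ᶠ n in l, F.leadingCoeff * u (n + 1) = e * y n ^ 2) →
      (∀ᶠ n in l, F.leadingCoeff * u (n + k + 1) = e * y' n ^ 2) →
      (∀ᶠ n in l, σ e n (y n) ↔ σ e (n + k) (y' n)) →
      (∃ B, ∀ᶠ n in l, ν (e * y n * y' n - H.eval (u n)) ≤ B) ∧
      ((¬ ∃ B, ∀ n, ν (u n) ≤ B) →
        Tendsto (fun n => ν (e * y n * y' n - H.eval (u n))) l (𝓝 0)) := by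
  obtain ⟨L, _, _, _, hν⟩ := hν
  let φ := Rat.castHom L
  have hφ : ∀ (P : ℚ[X]) (q : ℚ), ((P.eval q : ℚ) : L) = (P.map φ).eval (q : L) := fun P q =>
    (eval_map_apply φ q).symm
  have hdL : (F.map φ).natDegree = 2 * h := by rw [natDegree_map, hd]
  have hlc : ∀ P : ℚ[X], (P.map φ).leadingCoeff = (P.leadingCoeff : L) := fun P =>
    leadingCoeff_map φ
  have huL : ∀ n, (u (n + 1) : L) = (F.map φ).eval (u n : L) := fun n => by rw [hu, hφ]
  choose s hs using fun e : ℚ => IsAlgClosed.exists_pow_nat_eq (e : L) two_pos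
  refine ⟨fun e n y => ‖s e * y / (F.leadingCoeff * u n ^ h) - 1‖ ≤
    ‖s e * y / (F.leadingCoeff * u n ^ h) + 1‖, ?_⟩
  intro k e H hH hHc hR l hl y y' hy hy' hσ
  have hY : ∀ n, ((e * y n * y' n - H.eval (u n) : ℚ) : L) =
      (s e * y n) * (s e * y' n) - (H.map φ).eval (u n : L) := by
    intro n
    rw [← hφ]
    push_cast
    rw [← hs e]
    ring
  have h1 : ∀ᶠ n in l, (s e * y n) ^ 2 = (F.leadingCoeff : L) * u (n + 1) := by
    filter_upwards [hy] with n hn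
    rw [mul_pow, hs]
    exact_mod_cast hn.symm
  have h2 : ∀ᶠ n in l, (s e * y' n) ^ 2 = (F.leadingCoeff : L) * u (n + k + 1) := by
    filter_upwards [hy'] with n hn
    rw [mul_pow, hs]
    exact_mod_cast hn.symm
  simp only [hν, hY]
  rcases tendsto_cobounded_or_bounded (x := fun n => (u n : L)) (by omega) huL with ht | ⟨B, hB⟩
  · have hlim := tendsto_sub_of_sq_eq (H := H.map φ) (h := h) (k := k) hdL hh huL ht hl
      (η := fun n => s e * y n) (η' := fun n => s e * y' n)
      (by rw [hlc]; exact h1) (by rw [hlc]; exact h2) (by rw [hlc]; exact hσ)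
      (by rwa [natDegree_map])
      (by rw [coeff_map, hHc, hlc, ← map_polyIter, hlc]; simp [φ])
      (by
        rw [hlc, ← map_polyIter]
        convert hR using 1
        rw [← degree_map_eq_of_injective φ.injective]
        simp [φ])
    have hlim' := hlim.norm
    rw [norm_zero] at hlim'
    exact ⟨⟨1, hlim'.eventually_le_const one_pos⟩, fun _ => hlim'⟩
  · refine ⟨?_, fun h => absurd ⟨B, hB⟩ h⟩
    have hB0 : 0 ≤ B := (norm_nonneg _).trans (hB 0)
    have hbd : ∀ P : L[X], ∃ B', ∀ n, ‖P.eval (u n : L)‖ ≤ B' := by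
      intro P
      induction P using Polynomial.induction_on' with
      | add P Q hP hQ =>
        obtain ⟨B₁, h₁⟩ := hP
        obtain ⟨B₂, h₂⟩ := hQ
        exact ⟨B₁ + B₂, fun n => by
          rw [eval_add]; exact (norm_add_le _ _).trans (add_le_add (h₁ n) (h₂ n))⟩
      | monomial i c =>
        refine ⟨‖c‖ * B ^ i, fun n => ?_⟩
        rw [eval_monomial, norm_mul, norm_pow]
        gcongr
        exact hB n
    obtain ⟨B', hB'⟩ := hbd (H.map φ)
    refine ⟨‖(F.leadingCoeff : L)‖ * B + B', ?_⟩
    filter_upwards [h1, h2] with n hn hn'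
    refine (norm_sub_le _ _).trans (add_le_add ?_ (hB' n))
    apply le_of_sq_le_sq _ (by positivity)
    rw [← norm_pow, mul_pow, hn, hn', norm_mul, norm_mul, norm_mul]
    calc _ = ‖(F.leadingCoeff : L)‖ ^ 2 * (‖(u (n + 1) : L)‖ * ‖(u (n + k + 1) : L)‖) := by ring
      _ ≤ ‖(F.leadingCoeff : L)‖ ^ 2 * (B * B) := by gcongr <;> apply hB
      _ = _ := by ring

end PlaceDichotomy

section Window

open Filter Topology

/-- A colouring with finitely many colours for which no colour recurs infinitely often at a
fixed distance cannot colour arbitrarily long windows far out. -/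
theorem exists_window_of_coloring {α : Type*} (s : Finset α) {bad : ℕ → Prop} {c : ℕ → α}
    (hc : ∀ n, bad n → c n ∈ s)
    (h : ∀ k, 1 ≤ k → ∀ x ∈ s, ∀ᶠ n in atTop,
      ¬ (bad n ∧ bad (n + k) ∧ c n = x ∧ c (n + k) = x)) :
    ∃ W n₀ : ℕ, ∀ n, n₀ ≤ n → ∃ m, n ≤ m ∧ m < n + W ∧ ¬ bad m := by
  have h' : ∀ᶠ n in atTop, ∀ k ∈ Finset.Icc 1 (s.card + 1), ∀ x ∈ s,
      ¬ (bad n ∧ bad (n + k) ∧ c n = x ∧ c (n + k) = x) :=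
    (eventually_all_finset _).2 fun k hk => (eventually_all_finset _).2 fun x hx =>
      h k (Finset.mem_Icc.1 hk).1 x hx
  obtain ⟨n₀, hn₀⟩ := eventually_atTop.1 h'
  refine ⟨s.card + 1, n₀, fun n hn => ?_⟩
  by_contra! hbad
  obtain ⟨i, hi, j, hj, hij, hcol⟩ := Finset.exists_ne_map_eq_of_card_lt_of_maps_to
    (s := Finset.Ico n (n + (s.card + 1))) (t := s) (f := c) (by simp)
    (fun m hm => by
      have := Finset.mem_Ico.1 hm
      exact hc m (hbad m this.1 this.2))
  wlog hlt : i < j generalizing i j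
  · exact this j hj i hi hij.symm hcol.symm (by omega)
  obtain ⟨hi1, hi2⟩ := Finset.mem_Ico.1 hi
  obtain ⟨hj1, hj2⟩ := Finset.mem_Ico.1 hj
  have hj' : i + (j - i) = j := by omega
  refine hn₀ i (by omega) (j - i) (Finset.mem_Icc.2 (by omega)) (c i) (hc i (hbad i hi1 hi2)) ?_
  rw [hj']
  exact ⟨hbad i hi1 hi2, hbad j hj1 hj2, rfl, hcol.symm⟩

theorem exists_padicNorm_mul_eval_le_one (H : ℚ[X]) :
    ∃ D : ℤ, D ≠ 0 ∧ ∀ p : ℕ, p.Prime → ∀ x : ℚ, padicNorm p x ≤ 1 →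
      padicNorm p (D * H.eval x) ≤ 1 := by
  obtain ⟨D, hD, hDH⟩ := IsLocalization.integerNormalization_spec (nonZeroDivisors ℤ) H
  refine ⟨D, nonZeroDivisors.ne_zero hD, fun p hp x hx => ?_⟩
  have := Fact.mk hp
  have h := padicNorm_aeval_le_one hx (IsLocalization.integerNormalization (nonZeroDivisors ℤ) H)
  rw [aeval_def, ← eval_map, hDH] at h
  simpa using h

theorem ratPlace_mul {S : Finset ℕ} (hS : ∀ p ∈ S, p.Prime) {i : ℕ} (hi : i ∈ insert 0 S)
    (x y : ℚ) : ratPlace i (x * y) = ratPlace i x * ratPlace i y := by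
  obtain ⟨L, _, _, _, hL⟩ := exists_normedField_ratPlace hS hi
  simp [hL]

theorem ratPlace_nonneg {S : Finset ℕ} (hS : ∀ p ∈ S, p.Prime) {i : ℕ} (hi : i ∈ insert 0 S)
    (x : ℚ) : 0 ≤ ratPlace i x := by
  obtain ⟨L, _, _, _, hL⟩ := exists_normedField_ratPlace hS hi
  simp [hL]

/-- Product formula obstruction: an infinite set of `S`-integers cannot have `S`-integral values
approximated by a fixed polynomial, with error bounded at all places of `S` and tending to zero at
the places where the set is unbounded. -/
theorem false_of_tendsto_ratPlace {S : Finset ℕ} (hS : ∀ p ∈ S, p.Prime) {u : ℕ → ℚ}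
    (hu : Function.Injective u) (huS : ∀ p, p.Prime → p ∉ S → ∀ n, padicNorm p (u n) ≤ 1)
    (H : ℚ[X]) {l : Filter ℕ} [l.NeBot] {v : ℕ → ℚ}
    (hv : ∀ᶠ n in l, ∀ p, p.Prime → p ∉ S → padicNorm p (v n) ≤ 1)
    (hne : ∀ᶠ n in l, v n ≠ H.eval (u n))
    (hb : ∀ i ∈ insert 0 S, (∃ B, ∀ᶠ n in l, ratPlace i (v n - H.eval (u n)) ≤ B) ∧
      ((¬ ∃ B, ∀ n, ratPlace i (u n) ≤ B) →
        Tendsto (fun n => ratPlace i (v n - H.eval (u n))) l (𝓝 0))) : False := by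
  classical
  obtain ⟨i₀, hi₀, hub⟩ : ∃ i ∈ insert 0 S, ¬ ∃ B, ∀ n, ratPlace i (u n) ≤ B := by
    by_contra! hcon
    choose! B hB using hcon
    refine Set.infinite_of_injective_forall_mem hu (fun n => ?_)
      (finite_setOf_ratPlace_le hS (∑ i ∈ insert 0 S, |B i|))
    refine ⟨fun p hp hpS => huS p hp hpS n, fun i hi => (hB i hi n).trans ?_⟩
    exact (le_abs_self _).trans (Finset.single_le_sum (f := fun i => |B i|)
      (fun _ _ => abs_nonneg _) hi)
  obtain ⟨D, hD, hDint⟩ := exists_padicNorm_mul_eval_le_one H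
  choose! B hB using fun i hi => (hb i hi).1
  have hlim : Tendsto (fun n => (∏ i ∈ insert 0 S, ratPlace i (D : ℚ)) *
      ((∏ i ∈ (insert 0 S).erase i₀, B i) * ratPlace i₀ (v n - H.eval (u n)))) l (𝓝 0) := by
    have := ((hb i₀ hi₀).2 hub).const_mul ((∏ i ∈ insert 0 S, ratPlace i (D : ℚ)) *
      (∏ i ∈ (insert 0 S).erase i₀, B i))
    simpa [mul_assoc] using this
  have hall : ∀ᶠ n in l, ∀ i ∈ insert 0 S, ratPlace i (v n - H.eval (u n)) ≤ B i :=
    (eventually_all_finset _).2 hB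
  obtain ⟨n, h1, h2, h3, h4⟩ :=
    ((hlim.eventually_lt_const one_pos).and (hall.and (hv.and hne))).exists
  refine h1.not_ge ?_
  have hq : (1 : ℝ) ≤ ∏ i ∈ insert 0 S, ratPlace i (D * (v n - H.eval (u n))) := by
    apply one_le_prod_ratPlace hS (mul_ne_zero (by exact_mod_cast hD) (sub_ne_zero.2 h4))
    intro p hp hpS
    have := Fact.mk hp
    rw [mul_sub]
    refine padicNorm.sub.trans (max_le ?_ (hDint p hp _ (huS p hp hpS n)))
    rw [padicNorm.mul]
    exact mul_le_one₀ (padicNorm.of_int _) (padicNorm.nonneg _) (h3 p hp hpS)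
  refine hq.trans ?_
  rw [Finset.prod_congr rfl fun i hi => ratPlace_mul hS hi _ _, Finset.prod_mul_distrib]
  refine mul_le_mul_of_nonneg_left ?_ (Finset.prod_nonneg fun i hi => ratPlace_nonneg hS hi _)
  rw [← Finset.prod_erase_mul _ _ hi₀]
  refine mul_le_mul_of_nonneg_right ?_ (ratPlace_nonneg hS hi₀ _)
  exact Finset.prod_le_prod (fun i hi => ratPlace_nonneg hS (Finset.mem_of_mem_erase hi) _)
    fun i hi => h2 i (Finset.mem_of_mem_erase hi)

theorem exists_approx_sqrt_orbit {f g : ℤ[X]} {a b : ℤ} {h : ℕ} (hd : f.natDegree = 2 * h)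
    (hh : h ≠ 0) (hder : derivative f = g ^ 2 * (C a * X + C b)) (ha : a ≠ 0)
    (hγ : aeval (-(b : ℚ) / a) f ≠ 0) {F : ℚ[X]} (hF : F = f.map (Int.castRingHom ℚ)) {k : ℕ}
    (hk : (polyIter f k).eval 0 ≠ 0) :
    ∃ H : ℚ[X], H.natDegree ≤ h + (2 * h) ^ k * h ∧
      H.coeff (h + (2 * h) ^ k * h) = F.leadingCoeff ^ 2 * (polyIter F k).leadingCoeff ^ h ∧
      (C (F.leadingCoeff ^ 2) * F * polyIter F (k + 1) - H ^ 2).degree <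
        ((h + (2 * h) ^ k * h : ℕ) : WithBot ℕ) ∧
      C (F.leadingCoeff ^ 2) * F * polyIter F (k + 1) - H ^ 2 ≠ 0 := by
  have hdF : F.natDegree = 2 * h := by
    rw [hF, natDegree_map_eq_of_injective (RingHom.injective_int _), hd]
  have hF0 : F ≠ 0 := by rintro rfl; simp at hdF; omega
  have hA : F.leadingCoeff ≠ 0 := leadingCoeff_ne_zero.2 hF0
  have hP : ∀ n, polyIter F n ≠ 0 := fun n h0 => by
    have := natDegree_polyIter F n
    rw [h0, hdF, natDegree_zero] at this
    exact (pow_pos (by omega) n).ne this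
  have hdT : (C (F.leadingCoeff ^ 2) * F * polyIter F (k + 1)).natDegree =
      2 * (h + (2 * h) ^ k * h) := by
    rw [natDegree_mul (mul_ne_zero (by simpa using hA) hF0) (hP _), natDegree_C_mul
      (pow_ne_zero _ hA), natDegree_polyIter, hdF]
    ring
  have hlT : (C (F.leadingCoeff ^ 2) * F * polyIter F (k + 1)).leadingCoeff =
      (F.leadingCoeff ^ 2 * (polyIter F k).leadingCoeff ^ h) ^ 2 := by
    rw [leadingCoeff_mul, leadingCoeff_mul, leadingCoeff_C]
    have : (polyIter F (k + 1)).leadingCoeff =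
        F.leadingCoeff * (polyIter F k).leadingCoeff ^ (2 * h) := by
      rw [polyIter_succ, leadingCoeff_comp, hdF]
      rw [natDegree_polyIter, hdF]
      exact (pow_pos (by omega) k).ne'
    rw [this]
    ring
  obtain ⟨H, h1, h2, h3⟩ := exists_degree_sub_sq_lt
    (T := C (F.leadingCoeff ^ 2) * F * polyIter F (k + 1)) (m := h + (2 * h) ^ k * h)
    (mul_ne_zero (pow_ne_zero 2 hA) (pow_ne_zero h (leadingCoeff_ne_zero.2 (hP k)))) hdT.le
    (by rw [← hdT, coeff_natDegree, hlT])
  refine ⟨H, h1, h2, h3, fun h0 => ?_⟩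
  let φ := algebraMap ℚ (AlgebraicClosure ℚ)
  have hcomp : φ.comp (Int.castRingHom ℚ) = Int.castRingHom _ := RingHom.ext_int _ _
  have hFm : F.map φ = f.map (Int.castRingHom _) := by rw [hF, Polynomial.map_map, hcomp]
  have hAφ : φ F.leadingCoeff ≠ 0 := (map_ne_zero φ).2 hA
  refine not_isSquare_mul_of_derivative (K := AlgebraicClosure ℚ) (F := F.map φ)
    (g := g.map (Int.castRingHom _)) (G := C (φ F.leadingCoeff ^ 2) * polyIter (F.map φ) (k + 1))
    (a := a) (b := b) (by exact_mod_cast ha) ?_ ?_ ?_ ?_ ?_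
  · rw [hFm, derivative_map, hder]
    simp
  · rw [natDegree_map, hdF]; omega
  · intro hz
    apply hγ
    have : (-(b : AlgebraicClosure ℚ) / a) = φ (-(b : ℚ) / a) := by simp [φ]
    rw [this, eval_map_apply, map_eq_zero, hF, eval_map] at hz
    rwa [aeval_def]
  · intro θ hθ
    rw [eval_mul, eval_C]
    refine mul_ne_zero (pow_ne_zero _ hAφ) ?_
    rw [polyIter_add, eval_comp, polyIter_one, hθ, hFm, ← map_polyIter, eval_zero_map]
    simpa using hk
  · refine ⟨H.map φ, ?_⟩
    have := congrArg (Polynomial.map φ) (sub_eq_zero.1 h0)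
    rw [← pow_two, ← Polynomial.map_pow, ← this]
    simp [map_polyIter]
    ring

theorem exists_window {f g : ℤ[X]} {a b : ℤ} (hdeg : 2 ≤ f.natDegree)
    (hder : derivative f = g ^ 2 * (C a * X + C b)) (ha : a ≠ 0) (h0 : IsPreperiodicPt f 0)
    (hγ : ¬ IsPreperiodicPt f (-(b : ℚ) / a)) (hc : ∀ k, 1 ≤ k → (polyIter f k).eval 0 ≠ 0)
    (M : ℕ) :
    ∃ W n₀ : ℕ, ∀ n, n₀ ≤ n → ∃ m, n ≤ m ∧ m < n + W ∧ ¬ ∃ (e : ℤ) (y : ℚ), e ≠ 0 ∧ |e| ≤ M ∧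
      (f.leadingCoeff : ℚ) * aeval (-(b : ℚ) / a) (polyIter f (m + 1)) = e * y ^ 2 := by
  classical
  obtain ⟨h, hd⟩ := natDegree_even_of_derivative hdeg ha hder
  rw [← two_mul] at hd
  have hh : h ≠ 0 := by rintro rfl; omega
  set F := f.map (Int.castRingHom ℚ) with hF
  set u : ℕ → ℚ := fun n => aeval (-(b : ℚ) / a) (polyIter f n) with hu
  have hdF : F.natDegree = 2 * h := by
    rw [hF, natDegree_map_eq_of_injective (RingHom.injective_int _), hd]
  have hlF : F.leadingCoeff = f.leadingCoeff := by
    rw [hF, leadingCoeff_map_of_injective (RingHom.injective_int _)]; simp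
  have hev : ∀ (P : ℤ[X]) (x : ℚ), (P.map (Int.castRingHom ℚ)).eval x = aeval x P := fun P x => by
    rw [eval_map, aeval_def]; rfl
  have huk : ∀ n k, u (n + k) = (polyIter F k).eval (u n) := fun n k => by
    rw [hF, ← map_polyIter, hev, hu]
    simp only
    rw [add_comm, aeval_polyIter_add]
  have hu1 : ∀ n, u (n + 1) = F.eval (u n) := fun n => by rw [huk, polyIter_one]
  have huinj : Function.Injective u := injective_orbit hγ
  set S := a.natAbs.primeFactors
  have hS : ∀ p ∈ S, p.Prime := fun p hp => Nat.prime_of_mem_primeFactors hp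
  have huS : ∀ p, p.Prime → p ∉ S → ∀ n, padicNorm p (u n) ≤ 1 := by
    intro p hp hpS n
    have := Fact.mk hp
    refine padicNorm_aeval_le_one ?_ _
    have hpa : ¬ p ∣ a.natAbs := fun h => hpS (Nat.mem_primeFactors.2 ⟨hp, h, by simpa using ha⟩)
    have : padicNorm p (a : ℚ) = 1 :=
      padicNorm.int_eq_one_iff a |>.2 (by rwa [Int.natCast_dvd])
    rw [padicNorm.div, this, div_one, padicNorm.neg]
    exact padicNorm.of_int _
  choose! σ hσ using fun i (hi : i ∈ insert 0 S) =>
    exists_sign_of_place (exists_normedField_ratPlace hS hi) hdF hh hu1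
  let bad : ℕ → Prop := fun m => ∃ (e : ℤ) (y : ℚ), e ≠ 0 ∧ |e| ≤ M ∧
    (f.leadingCoeff : ℚ) * u (m + 1) = e * y ^ 2
  choose! e y he0 heM hey using fun m (hm : bad m) => hm
  have hcM : ∀ m, bad m → (e m, (insert 0 S).filter fun i => σ i (e m) m (y m)) ∈
      Finset.Icc (-(M : ℤ)) M ×ˢ (insert 0 S).powerset := fun m hm => by
    rw [Finset.mem_product]
    exact ⟨Finset.mem_Icc.2 (abs_le.1 (heM m hm)), Finset.mem_powerset.2 (Finset.filter_subset _ _)⟩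
  refine exists_window_of_coloring _ hcM ?_
  rintro k hk ⟨ε, τ⟩ -
  by_contra hcon
  set P : Set ℕ := {n | bad n ∧ bad (n + k) ∧
    (e n, (insert 0 S).filter fun i => σ i (e n) n (y n)) = (ε, τ) ∧
    (e (n + k), (insert 0 S).filter fun i => σ i (e (n + k)) (n + k) (y (n + k))) = (ε, τ)}
  have hne : (atTop ⊓ 𝓟 P).NeBot := frequently_mem_iff_neBot.1 hcon
  have hPl : ∀ᶠ n in atTop ⊓ 𝓟 P, n ∈ P :=
    eventually_inf_principal.2 (Eventually.of_forall fun _ h => h)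
  have hle : atTop ⊓ 𝓟 P ≤ atTop := inf_le_left
  obtain ⟨H, hH1, hH2, hH3, hH4⟩ := exists_approx_sqrt_orbit hd hh hder ha
    (by simpa [polyIter_one] using orbit_ne_zero h0 hγ 1) hF (hc k hk)
  have e1 : ∀ᶠ n in atTop ⊓ 𝓟 P, F.leadingCoeff * u (n + 1) = ε * y n ^ 2 := by
    filter_upwards [hPl] with n hn
    rw [hlF, hey n hn.1, (Prod.mk.inj hn.2.2.1).1]
  have e2 : ∀ᶠ n in atTop ⊓ 𝓟 P, F.leadingCoeff * u (n + k + 1) = ε * y (n + k) ^ 2 := by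
    filter_upwards [hPl] with n hn
    rw [hlF, hey (n + k) hn.2.1, (Prod.mk.inj hn.2.2.2).1]
  have hsq : ∀ᶠ n in atTop ⊓ 𝓟 P, (ε * y n * y (n + k)) ^ 2 =
      F.leadingCoeff ^ 2 * u (n + 1) * u (n + k + 1) := by
    filter_upwards [e1, e2] with n h1 h2
    linear_combination (-(F.leadingCoeff * u (n + 1))) * h2 - ε * y (n + k) ^ 2 * h1
  refine false_of_tendsto_ratPlace hS huinj huS H (v := fun n => ε * y n * y (n + k)) ?_ ?_ ?_
    (l := atTop ⊓ 𝓟 P)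
  · filter_upwards [hsq] with n hn p hp hpS
    have := Fact.mk hp
    refine le_of_sq_le_sq ?_ zero_le_one
    rw [pow_two, ← padicNorm.mul, ← pow_two, hn, one_pow, hlF, ← Int.cast_pow]
    simp only [padicNorm.mul]
    exact mul_le_one₀ (mul_le_one₀ (padicNorm.of_int _) (padicNorm.nonneg _) (huS p hp hpS _))
      (padicNorm.nonneg _) (huS p hp hpS _)
  · have hfin :
        {n | (C (F.leadingCoeff ^ 2) * F * polyIter F (k + 1) - H ^ 2).eval (u n) = 0}.Finite :=
      (finite_setOfPred_isRoot hH4).preimage huinj.injOn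
    have : ∀ᶠ n in atTop ⊓ 𝓟 P,
        ¬ (C (F.leadingCoeff ^ 2) * F * polyIter F (k + 1) - H ^ 2).eval (u n) = 0 :=
      hle (by rw [← Nat.cofinite_eq_atTop]; exact hfin.compl_mem_cofinite)
    filter_upwards [this, hsq] with n h1 h2 h3
    apply h1
    rw [eval_sub, eval_pow, ← h3, h2, eval_mul, eval_mul, eval_C, ← hu1, ← huk]
    ring_nf
  · intro i hi
    refine hσ i hi k ε H hH1 hH2 hH3 _ hle _ _ e1 e2 ?_
    filter_upwards [hPl] with n hn
    have h1 := Prod.mk.inj hn.2.2.1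
    have h2 := Prod.mk.inj hn.2.2.2
    have h3 := Finset.ext_iff.1 (h1.2.trans h2.2.symm) i
    simpa [hi, h1.1, h2.1] using h3

end Window

section OrbitArithmetic

theorem not_dynIrred_of_eval_zero {f : ℤ[X]} (hdeg : 2 ≤ f.natDegree) {k : ℕ} (hk : 1 ≤ k)
    (h0 : (polyIter f k).eval 0 = 0) {p : ℕ} (hp : p.Prime) (hpA : ¬ (p : ℤ) ∣ f.leadingCoeff) :
    ¬ DynIrred (f.map (Int.castRingHom (ZMod p))) := by
  intro h
  have := Fact.mk hp
  have h1 := degree_eq_one_of_irreducible_of_root (h k hk) (x := 0) (by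
    rw [← map_polyIter, IsRoot, eval_zero_map, h0, map_zero])
  have h2 : _ = 1 := natDegree_eq_of_degree_eq_some h1
  rw [natDegree_polyIter, natDegree_map_of_leadingCoeff_ne_zero _ (by
    rwa [eq_intCast, Ne, ZMod.intCast_zmod_eq_zero_iff_dvd])] at h2
  have := Nat.pow_le_pow_left hdeg k
  have := Nat.pow_le_pow_right two_pos hk
  omega

theorem exists_eval_zero_dvd {f : ℤ[X]} (h0 : IsPreperiodicPt f 0)
    (hc : ∀ k, 1 ≤ k → (polyIter f k).eval 0 ≠ 0) :
    ∃ M : ℤ, M ≠ 0 ∧ ∀ k, 1 ≤ k → (polyIter f k).eval 0 ∣ M := by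
  have hfin : {x : ℤ | ∃ k, 1 ≤ k ∧ x = (polyIter f k).eval 0}.Finite := by
    refine (h0.preimage (Int.cast_injective (α := ℚ)).injOn).subset ?_
    rintro x ⟨k, hk, rfl⟩
    exact ⟨k, hk, by simp [aeval_def, eval₂_at_zero, ← coeff_zero_eq_eval_zero]⟩
  refine ⟨∏ x ∈ hfin.toFinset, x, Finset.prod_ne_zero_iff.2 fun x hx => ?_, fun k hk =>
    Finset.dvd_prod_of_mem _ ((Set.Finite.mem_toFinset _).2 ⟨k, hk, rfl⟩)⟩
  obtain ⟨k, hk, rfl⟩ := (Set.Finite.mem_toFinset _).1 hx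
  exact hc k hk

theorem dvd_eval_zero_of_dvd_homIter {f : ℤ[X]} {a b : ℤ} {q : ℕ} (hq : q.Prime)
    (hqa : ¬ (q : ℤ) ∣ a) {m n : ℕ} (hm : (q : ℤ) ∣ homIter f a b m)
    (hn : (q : ℤ) ∣ homIter f a b (n + m)) : (q : ℤ) ∣ (polyIter f n).eval 0 := by
  have := Fact.mk hq
  have ha : Int.castRingHom (ZMod q) a ≠ 0 := by
    rwa [eq_intCast, Ne, ZMod.intCast_zmod_eq_zero_iff_dvd]
  have key : ∀ j, (q : ℤ) ∣ homIter f a b j →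
      (polyIter (f.map (Int.castRingHom (ZMod q))) j).eval
        (-Int.castRingHom (ZMod q) b / Int.castRingHom (ZMod q) a) = 0 := by
    intro j hj
    have h := map_homIter (Int.castRingHom (ZMod q)) f b ha j
    rw [eq_intCast (Int.castRingHom (ZMod q)) (homIter f a b j),
      (ZMod.intCast_zmod_eq_zero_iff_dvd _ _).2 hj] at h
    exact (mul_eq_zero.1 h.symm).resolve_left (pow_ne_zero _ ha)
  have h := key _ hn
  rw [polyIter_add, eval_comp, key _ hm, ← map_polyIter, eval_zero_map, eq_intCast,
    ZMod.intCast_zmod_eq_zero_iff_dvd] at h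
  exact h

theorem exists_prime_or_eq_mul_sq {N M : ℤ} (hN : N ≠ 0) (hM : M ≠ 0) :
    (∃ (q v : ℕ) (N' : ℤ), q.Prime ∧ Odd v ∧ ¬ (q : ℤ) ∣ M ∧ ¬ (q : ℤ) ∣ N' ∧ N = q ^ v * N') ∨
      ∃ e y : ℤ, e ≠ 0 ∧ |e| ≤ |M| ∧ N = e * y ^ 2 := by
  obtain ⟨c, t, -, ht, hct, hc⟩ := Nat.sq_mul_squarefree_of_pos (Int.natAbs_pos.2 hN)
  have hNs : N = N.sign * (t ^ 2 * c) := by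
    conv_lhs => rw [← Int.sign_mul_natAbs N, ← hct]
    push_cast
    ring
  by_cases h : c.primeFactors ⊆ M.natAbs.primeFactors
  · right
    have hcM : c ∣ M.natAbs := by
      rw [← Nat.prod_primeFactors_of_squarefree hc]
      exact (Finset.prod_dvd_prod_of_subset _ _ _ h).trans (Nat.prod_primeFactors_dvd _)
    have hle := Nat.le_of_dvd (Int.natAbs_pos.2 hM) hcM
    refine ⟨N.sign * c, t, mul_ne_zero (by simpa using hN) (by exact_mod_cast hc.ne_zero), ?_, ?_⟩
    · rw [abs_mul, Int.abs_sign_of_ne_zero hN, one_mul, Nat.abs_cast, Int.abs_eq_natAbs]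
      exact_mod_cast hle
    · linear_combination hNs
  · left
    obtain ⟨q, hqc, hqM⟩ := Finset.not_subset.1 h
    have hq := Nat.prime_of_mem_primeFactors hqc
    have hqp := Nat.prime_iff_prime_int.1 hq
    have hqc' := Nat.dvd_of_mem_primeFactors hqc
    obtain ⟨c', rfl⟩ := hqc'
    obtain ⟨j, t', ht', rfl⟩ := Nat.exists_eq_pow_mul_and_not_dvd ht.ne' q hq.ne_one
    refine ⟨q, 2 * j + 1, N.sign * (t' ^ 2 * c'), hq, ⟨j, rfl⟩, fun hd => hqM ?_, fun hd => ?_, ?_⟩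
    · exact Nat.mem_primeFactors.2 ⟨hq, Int.natCast_dvd.1 hd, by simpa using hM⟩
    · rcases hqp.dvd_or_dvd hd with hd | hd
      · have := Int.natCast_dvd.1 hd
        rw [Int.natAbs_sign_of_ne_zero hN] at this
        exact hq.one_lt.ne' (Nat.dvd_one.1 this)
      · rcases hqp.dvd_or_dvd hd with hd | hd
        · exact ht' (by exact_mod_cast hqp.dvd_of_dvd_pow hd)
        · have hdq : q ∣ c' := by exact_mod_cast hd
          have := (Nat.squarefree_mul_iff.1 hc).1
          exact hq.one_lt.ne' (Nat.dvd_one.1 (this ▸ Nat.dvd_gcd dvd_rfl hdq))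
    · refine hNs.trans ?_
      push_cast
      ring

theorem exists_abs_homIter_le {f : ℤ[X]} (hdeg : 2 ≤ f.natDegree) {a : ℤ} (b : ℤ) (ha : a ≠ 0) :
    ∃ B : ℝ, 1 < B ∧ ∀ n, |((f.leadingCoeff * homIter f a b n : ℤ) : ℝ)| ≤
      B ^ f.natDegree ^ n := by
  set u : ℕ → ℚ := fun n => aeval (-(b : ℚ) / a) (polyIter f n) with hu
  have hu1 : ∀ n, u (n + 1) = aeval (u n) f := fun n => by
    rw [hu]
    simp only
    rw [add_comm, aeval_polyIter_add, polyIter_one]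
  set c : ℚ := 1 + ∑ i ∈ Finset.range (f.natDegree + 1), |(f.coeff i : ℚ)| with hc
  have hc0 : 0 ≤ ∑ i ∈ Finset.range (f.natDegree + 1), |(f.coeff i : ℚ)| :=
    Finset.sum_nonneg fun _ _ => abs_nonneg _
  have hc1 : 1 ≤ c := by linarith
  have hstep : ∀ n, max 1 |u (n + 1)| ≤ c * max 1 |u n| ^ f.natDegree := by
    intro n
    have h1 : 1 ≤ max 1 |u n| := le_max_left _ _
    refine max_le (one_le_mul_of_one_le_of_one_le hc1 (one_le_pow₀ h1)) ?_
    rw [hu1, aeval_eq_sum_range]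
    refine (Finset.abs_sum_le_sum_abs _ _).trans ?_
    calc _ ≤ ∑ i ∈ Finset.range (f.natDegree + 1),
          |(f.coeff i : ℚ)| * max 1 |u n| ^ f.natDegree := by
          refine Finset.sum_le_sum fun i hi => ?_
          rw [zsmul_eq_mul, abs_mul, abs_pow]
          refine mul_le_mul_of_nonneg_left ?_ (abs_nonneg _)
          exact (pow_le_pow_left₀ (abs_nonneg _) (le_max_right _ _) i).trans
            (pow_le_pow_right₀ h1 (Nat.lt_succ_iff.1 (Finset.mem_range.1 hi)))
      _ ≤ _ := by
          rw [← Finset.sum_mul]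
          exact mul_le_mul_of_nonneg_right (by linarith) (by positivity)
  have hbd : ∀ n, c * max 1 |u n| ≤ (c * max 1 |u 0|) ^ f.natDegree ^ n := by
    intro n
    induction n with
    | zero => simp
    | succ n ih =>
      calc c * max 1 |u (n + 1)| ≤ c * (c * max 1 |u n| ^ f.natDegree) := by
            gcongr
            exact hstep n
        _ = c ^ 2 * max 1 |u n| ^ f.natDegree := by ring
        _ ≤ c ^ f.natDegree * max 1 |u n| ^ f.natDegree := by gcongr
        _ = (c * max 1 |u n|) ^ f.natDegree := by rw [mul_pow]
        _ ≤ ((c * max 1 |u 0|) ^ f.natDegree ^ n) ^ f.natDegree := by gcongr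
        _ = _ := by rw [← pow_mul, pow_succ]
  have hA : (1 : ℚ) ≤ |(f.leadingCoeff : ℚ)| := by
    have : f ≠ 0 := by rintro rfl; simp at hdeg
    exact_mod_cast Int.one_le_abs (leadingCoeff_ne_zero.2 this)
  refine ⟨((1 + |(f.leadingCoeff : ℚ)|) * (|(a : ℚ)| * (c * max 1 |u 0|)) : ℚ), ?_, fun n => ?_⟩
  · have h1 : (1 : ℚ) ≤ |(a : ℚ)| * (c * max 1 |u 0|) :=
      one_le_mul_of_one_le_of_one_le (by exact_mod_cast Int.one_le_abs ha)
        (one_le_mul_of_one_le_of_one_le hc1 (le_max_left _ _))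
    have : (1 : ℚ) < (1 + |(f.leadingCoeff : ℚ)|) * (|(a : ℚ)| * (c * max 1 |u 0|)) := by
      nlinarith
    exact_mod_cast this
  · suffices h : |((f.leadingCoeff * homIter f a b n : ℤ) : ℚ)| ≤
        ((1 + |(f.leadingCoeff : ℚ)|) * (|(a : ℚ)| * (c * max 1 |u 0|))) ^ f.natDegree ^ n by
      exact_mod_cast h
    rw [Int.cast_mul, cast_homIter f b ha, abs_mul, abs_mul, abs_pow, mul_pow, mul_pow]
    have hun : |u n| ≤ (c * max 1 |u 0|) ^ f.natDegree ^ n :=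
      (le_max_right 1 _).trans ((le_mul_of_one_le_left (by positivity) hc1).trans (hbd n))
    have hAn : |(f.leadingCoeff : ℚ)| ≤ (1 + |(f.leadingCoeff : ℚ)|) ^ f.natDegree ^ n :=
      (le_add_of_nonneg_left zero_le_one).trans
        (le_self_pow₀ (by linarith) (pow_pos (by omega) n).ne')
    gcongr

end OrbitArithmetic

section NonresidueFamily

theorem exists_finset_card_eq_of_window {P : ℕ → Prop} {W n₀ : ℕ}
    (h : ∀ n, n₀ ≤ n → ∃ m, n ≤ m ∧ m < n + W ∧ P m) (j : ℕ) :
    ∃ s : Finset ℕ, s.card = j ∧ ∀ m ∈ s, n₀ ≤ m ∧ m < n₀ + j * W ∧ P m := by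
  induction j with
  | zero => exact ⟨∅, rfl, by simp⟩
  | succ j ih =>
    obtain ⟨s, hs, hsP⟩ := ih
    obtain ⟨m, hm1, hm2, hm⟩ := h (n₀ + j * W) (Nat.le_add_right _ _)
    refine ⟨insert m s, ?_, ?_⟩
    · rw [Finset.card_insert_of_notMem, hs]
      intro hms
      exact absurd (hsP m hms).2.1 (by omega)
    · intro i hi
      rw [add_mul, one_mul]
      rcases Finset.mem_insert.1 hi with rfl | hi
      · exact ⟨by omega, by omega, hm⟩
      · obtain ⟨h1, h2, h3⟩ := hsP i hi
        exact ⟨h1, by omega, h3⟩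

theorem exists_nonresidue_family {f g : ℤ[X]} {a b : ℤ} (hdeg : 2 ≤ f.natDegree)
    (hder : derivative f = g ^ 2 * (C a * X + C b)) (ha : a ≠ 0) (h0 : IsPreperiodicPt f 0)
    (hγ : ¬ IsPreperiodicPt f (-(b : ℚ) / a)) (hc : ∀ k, 1 ≤ k → (polyIter f k).eval 0 ≠ 0) :
    ∃ (α β : ℝ) (P : ℕ), 0 < α ∧ 1 < β ∧ ∀ j : ℕ, ∃ (s : Finset ℕ) (N : ℕ → ℤ), s.card = j ∧
      (∀ i ∈ s, N i ≠ 0) ∧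
      (∀ i ∈ s, ∀ i' ∈ s, i ≠ i' → ∃ r, oddJacobi (N i * N i') r = -1) ∧
      (∀ i ∈ s, |(N i : ℝ)| ≤ Real.exp (α * β ^ j)) ∧
      ∀ p, p.Prime → P < p → DynIrred (f.map (Int.castRingHom (ZMod p))) →
        ∀ i ∈ s, oddJacobi (N i) p = -1 := by
  have hd := natDegree_even_of_derivative hdeg ha hder
  have hA : f.leadingCoeff ≠ 0 := leadingCoeff_ne_zero.2 (by rintro rfl; simp at hdeg)
  have haQ : (a : ℚ) ≠ 0 := by exact_mod_cast ha
  obtain ⟨M₁, hM₁, hM₁dvd⟩ := exists_eval_zero_dvd h0 hc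
  set M : ℤ := 2 * a * f.leadingCoeff * M₁ with hM
  have hM0 : M ≠ 0 := by simp [hM, ha, hA, hM₁]
  obtain ⟨B, hB1, hB⟩ := exists_abs_homIter_le hdeg b ha
  obtain ⟨W, n₀, hW⟩ := exists_window hdeg hder ha h0 hγ hc M.natAbs
  set N : ℕ → ℤ := fun n => f.leadingCoeff * homIter f a b n
  have hN0 : ∀ n, N n ≠ 0 := fun n => by
    refine mul_ne_zero hA fun h => ?_
    have := cast_homIter f b ha n
    rw [h, Int.cast_zero] at this
    exact mul_ne_zero (pow_ne_zero _ haQ) (orbit_ne_zero h0 hγ n) this.symm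
  let good : ℕ → Prop := fun n => ∃ (q v : ℕ) (N' : ℤ),
    q.Prime ∧ Odd v ∧ ¬ (q : ℤ) ∣ M ∧ ¬ (q : ℤ) ∣ N' ∧ N n = q ^ v * N'
  have hgood : ∀ n, max n₀ 1 ≤ n → ∃ m, n ≤ m ∧ m < n + W ∧ good (m + 1) := by
    intro n hn
    obtain ⟨m, hm1, hm2, hm⟩ := hW n (le_of_max_le_left hn)
    refine ⟨m, hm1, hm2, (exists_prime_or_eq_mul_sq (hN0 _) hM0).resolve_right ?_⟩
    rintro ⟨e, y, he, heM, hey⟩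
    obtain ⟨t, ht⟩ := hd.pow_of_ne_zero (Nat.succ_ne_zero m)
    refine hm ⟨e, y / a ^ t, he, by rwa [Int.natCast_natAbs], ?_⟩
    have hey' : (f.leadingCoeff : ℚ) * homIter f a b (m + 1) = e * y ^ 2 := by exact_mod_cast hey
    rw [cast_homIter f b ha, ht] at hey'
    have hat : (a : ℚ) ^ t ≠ 0 := pow_ne_zero _ haQ
    rw [div_pow, mul_div_assoc', eq_div_iff (pow_ne_zero _ hat), ← hey']
    ring
  have hpair : ∀ i i', good i → i ≠ i' → ∃ r, oddJacobi (N i * N i') r = -1 := by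
    rintro i i' ⟨q, v, N', hq, hv, hqM, hqN', hi⟩ hne
    have hqp := Nat.prime_iff_prime_int.1 hq
    have hqA : ¬ (q : ℤ) ∣ f.leadingCoeff := fun h => hqM (by
      rw [hM]; exact (h.mul_left _).mul_right _)
    have hqa : ¬ (q : ℤ) ∣ a := fun h => hqM (by
      rw [hM]; exact ((h.mul_left _).mul_right _).mul_right _)
    have hq2 : q ≠ 2 := by
      rintro rfl
      exact hqM (by rw [hM, mul_assoc, mul_assoc]; exact dvd_mul_right _ _)
    have hqM₁ : ∀ k, 1 ≤ k → ¬ (q : ℤ) ∣ (polyIter f k).eval 0 := fun k hk h =>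
      hqM ((h.trans (hM₁dvd k hk)).mul_left _)
    have hqi : (q : ℤ) ∣ homIter f a b i := by
      refine (hqp.dvd_or_dvd (a := f.leadingCoeff) ?_).resolve_left hqA
      rw [show f.leadingCoeff * homIter f a b i = N i from rfl, hi]
      exact (dvd_pow_self _ hv.pos.ne').mul_right _
    have hqi' : ¬ (q : ℤ) ∣ N i' := by
      intro h
      have hd' := (hqp.dvd_or_dvd h).resolve_left hqA
      rcases hne.lt_or_gt with hlt | hlt
      · refine hqM₁ (i' - i) (by omega) (dvd_eval_zero_of_dvd_homIter hq hqa hqi ?_)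
        rwa [Nat.sub_add_cancel hlt.le]
      · refine hqM₁ (i - i') (by omega) (dvd_eval_zero_of_dvd_homIter hq hqa hd' ?_)
        rwa [Nat.sub_add_cancel hlt.le]
    rw [hi, mul_assoc]
    exact exists_oddJacobi_eq_neg_one hq hq2 hv (hqp.not_dvd_mul hqN' hqi')
  have hd0 : (0 : ℝ) < f.natDegree := by exact_mod_cast (by omega : 0 < f.natDegree)
  have hd1 : (1 : ℝ) < f.natDegree := by exact_mod_cast (by omega : 1 < f.natDegree)
  refine ⟨Real.log B * f.natDegree ^ (max n₀ 1), f.natDegree ^ (W + 1), M.natAbs,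
    mul_pos (Real.log_pos hB1) (by positivity), one_lt_pow₀ hd1 (by omega), fun j => ?_⟩
  obtain ⟨s, hs, hsg⟩ := exists_finset_card_eq_of_window hgood j
  refine ⟨s, fun i => N (i + 1), hs, fun i _ => hN0 _, fun i hi i' _ hne =>
    hpair _ _ (hsg i hi).2.2 (by omega), fun i hi => ?_, fun p hp hPp hdyn i hi => ?_⟩
  · refine (hB (i + 1)).trans ?_
    have hle : f.natDegree ^ (i + 1) ≤ f.natDegree ^ max n₀ 1 * (f.natDegree ^ (W + 1)) ^ j := by
      rw [← pow_mul, ← pow_add]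
      refine Nat.pow_le_pow_right (by omega) ?_
      have h1 := (hsg i hi).2.1
      have h2 : (W + 1) * j = j * W + j := by ring
      omega
    refine (pow_le_pow_right₀ hB1.le hle).trans_eq ?_
    rw [mul_assoc, Real.exp_mul, Real.exp_log (by positivity), ← Real.rpow_natCast]
    push_cast
    rfl
  · have hpM : ¬ (p : ℤ) ∣ M := fun h =>
      absurd (Nat.le_of_dvd (Int.natAbs_pos.2 hM0) (Int.natCast_dvd.1 h)) (by omega)
    refine oddJacobi_homIter hder hd hp ?_ (fun h => hpM ?_) (fun h => hpM ?_) hdyn ?_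
    · rintro rfl
      exact hpM (by rw [hM, mul_assoc, mul_assoc]; exact dvd_mul_right _ _)
    · rw [hM]; exact ((h.mul_left _).mul_right _).mul_right _
    · rw [hM]; exact (h.mul_left _).mul_right _
    · have := (hsg i hi).1
      omega

end NonresidueFamily

section Counting

open Filter

theorem eventually_growth_estimates (α L : ℝ) :
    ∀ᶠ x : ℝ in atTop, 1 ≤ x ∧ 4 * L ≤ Real.log x ∧ 16 * α ≤ Real.sqrt x ∧
      Real.exp (x / 16) + 1 ≤ Real.exp (x / 8) ∧ 9 * (x * Real.log x) ≤ Real.exp (3 / 8 * x) := by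
  have h16 : Tendsto (fun x : ℝ => Real.exp (x / 16)) atTop atTop :=
    Real.tendsto_exp_atTop.comp (tendsto_id.atTop_div_const (by norm_num))
  have hpow := (isLittleO_pow_exp_pos_mul_atTop 2 (show (0 : ℝ) < 3 / 8 by norm_num)).bound
    (show (0 : ℝ) < 1 / 9 by norm_num)
  filter_upwards [eventually_ge_atTop 1, Real.tendsto_log_atTop.eventually_ge_atTop (4 * L),
    Real.tendsto_sqrt_atTop.eventually_ge_atTop (16 * α), h16.eventually_ge_atTop 2, hpow]
    with x h1 h2 h3 h4 h5
  refine ⟨h1, h2, h3, ?_, ?_⟩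
  · rw [show x / 8 = x / 16 + x / 16 by ring, Real.exp_add]
    nlinarith
  · rw [Real.norm_of_nonneg (by positivity), Real.norm_of_nonneg (by positivity)] at h5
    have := Real.log_le_self (zero_le_one.trans h1)
    nlinarith

theorem card_le_of_nonresidue_family {α β : ℝ} (hα : 0 < α) (hβ : 1 < β) {A : ℕ → Set ℕ} {P : ℕ}
    (hA : ∀ Q, ∀ p ∈ A Q, p.Prime ∧ Q ≤ p ∧ p ≤ 2 * Q)
    (h : ∀ j : ℕ, ∃ (s : Finset ℕ) (N : ℕ → ℤ), s.card = j ∧ (∀ i ∈ s, N i ≠ 0) ∧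
      (∀ i ∈ s, ∀ i' ∈ s, i ≠ i' → ∃ r, oddJacobi (N i * N i') r = -1) ∧
      (∀ i ∈ s, |(N i : ℝ)| ≤ Real.exp (α * β ^ j)) ∧
      ∀ Q, P < Q → ∀ p ∈ A Q, ∀ i ∈ s, oddJacobi (N i) p = -1) :
    ∃ C : ℝ, 0 < C ∧ ∃ Q₀ : ℕ, ∀ Q : ℕ, Q₀ ≤ Q →
      ((A Q).ncard : ℝ) ≤ C * Q / (Real.log Q * Real.log (Real.log Q)) := by
  set L := Real.log β with hLdef
  have hL : 0 < L := Real.log_pos hβ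
  have hev := (Real.tendsto_log_atTop.comp tendsto_natCast_atTop_atTop).eventually
    (eventually_growth_estimates α L)
  obtain ⟨Q₀, hQ₀⟩ := eventually_atTop.1 (hev.and (eventually_gt_atTop P))
  refine ⟨256 * L + 1, by positivity, Q₀, fun Q hQ => ?_⟩
  obtain ⟨⟨hx1, hxL, hxα, hx16, hx9⟩, hPQ⟩ := hQ₀ Q hQ
  simp only [Function.comp_apply] at hx1 hxL hxα hx16 hx9
  set x := Real.log Q
  have hx0 : 0 < x := one_pos.trans_le hx1
  have hlx : 0 < Real.log x := by linarith
  have hQ0 : (0 : ℝ) < Q := by exact_mod_cast (Nat.zero_le P).trans_lt hPQ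
  have hQx : (Q : ℝ) = Real.exp x := (Real.exp_log hQ0).symm
  set j := ⌊Real.log x / (2 * L)⌋₊ with hj
  have hj1 : Real.log x / (4 * L) ≤ j := by
    have h1 := Nat.lt_floor_add_one (Real.log x / (2 * L))
    have h2 : 1 ≤ Real.log x / (4 * L) := by rwa [one_le_div (by positivity)]
    have h3 : Real.log x / (2 * L) = 2 * (Real.log x / (4 * L)) := by field_simp; norm_num
    rw [← hj] at h1
    linarith
  have hj0 : (0 : ℝ) < j := lt_of_lt_of_le (by positivity) hj1
  have hβj : β ^ j ≤ Real.sqrt x := by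
    have h1 : (j : ℝ) ≤ Real.log x / (2 * L) := Nat.floor_le (by positivity)
    rw [le_div_iff₀ (by positivity)] at h1
    rw [← Real.exp_log (zero_lt_one.trans hβ), ← hLdef, ← Real.exp_nat_mul,
      ← Real.exp_log (Real.sqrt_pos.2 hx0), Real.log_sqrt hx0.le, Real.exp_le_exp]
    linarith
  have hM : Real.exp (α * β ^ j) ^ 2 ≤ Real.exp (x / 8) := by
    rw [← Real.exp_nat_mul, Real.exp_le_exp]
    have h1 := Real.mul_self_sqrt hx0.le
    have h2 := Real.sqrt_nonneg x
    push_cast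
    nlinarith [mul_le_mul_of_nonneg_left hβj hα.le]
  set z := ⌊Real.exp (x / 8)⌋₊ with hz
  have hz1 : (z : ℝ) ≤ Real.exp (x / 8) := Nat.floor_le (Real.exp_pos _).le
  have hz2 : Real.exp (x / 16) ≤ z := by
    have := Nat.lt_floor_add_one (Real.exp (x / 8))
    rw [← hz] at this
    linarith
  have hz0 : (0 : ℝ) < z := (Real.exp_pos _).trans_le hz2
  have hzn : 1 ≤ z := by exact_mod_cast hz0
  have hz4 : (z : ℝ) ^ 4 ≤ Real.exp (x / 2) := by
    refine (pow_le_pow_left₀ hz0.le hz1 4).trans_eq ?_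
    rw [← Real.exp_nat_mul]
    congr 1
    push_cast
    ring
  have hH : x / 32 ≤ squarefreeHarmonic z := by
    have h1 := log_le_two_mul_squarefreeHarmonic z
    have h2 := (Real.le_log_iff_exp_le hz0).2 hz2
    linarith
  have hzQ : z < Q := by
    have : (z : ℝ) < Q := by
      rw [hQx]
      exact hz1.trans_lt (Real.exp_lt_exp.2 (by linarith))
    exact_mod_cast this
  have hfin : (A Q).Finite := (Set.finite_Icc Q (2 * Q)).subset fun p hp => (hA Q p hp).2
  obtain ⟨s, N, hs, hN0, hpair, hNM, hNp⟩ := h j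
  have hsieve := card_primes_nonresidue_mul_sq_le s N hN0 hpair hNM hzn
    (a := Q) (b := 2 * Q + 1) (by omega) hfin.toFinset fun p hp => by
      have hp' := hA Q p (hfin.mem_toFinset.1 hp)
      exact ⟨hp'.1, by omega, Finset.mem_Ico.2 (by omega), hNp Q hPQ p (hfin.mem_toFinset.1 hp)⟩
  rw [← Set.ncard_eq_toFinset_card _ hfin, hs] at hsieve
  push_cast at hsieve
  set t : ℝ := ((A Q).ncard : ℝ)
  have hjn : (1 : ℝ) ≤ j := by exact_mod_cast hj0
  have hH0 : 0 < squarefreeHarmonic z := lt_of_lt_of_le (by positivity) hH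
  have hmain : t ≤ (Q + 1) / (j * squarefreeHarmonic z) +
      (z ^ 4 + z ^ 4 * (8 * Real.exp (α * β ^ j) ^ 2)) := by
    have h1 : (2 * (Q : ℝ) + 1 - Q) = Q + 1 := by ring
    rw [h1] at hsieve
    have h2 : (z : ℝ) ^ 4 ≤ j * z ^ 4 := le_mul_of_one_le_left (by positivity) hjn
    have h3 : (Q + 1) / (j * squarefreeHarmonic z) * j ^ 2 =
        j * ((Q + 1) / squarefreeHarmonic z) := by field_simp
    refine le_of_mul_le_mul_right ?_ (pow_pos hj0 2)
    rw [add_mul, h3]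
    nlinarith
  have hfirst : (Q + 1) / (j * squarefreeHarmonic z) ≤ 256 * L * Q / (x * Real.log x) := by
    have hQ1 : (1 : ℝ) ≤ Q := by exact_mod_cast (Nat.zero_le P).trans_lt hPQ
    calc _ ≤ (2 * Q) / (Real.log x / (4 * L) * (x / 32)) := by
          gcongr
          linarith
      _ = _ := by field_simp; norm_num
  have hsecond : z ^ 4 + z ^ 4 * (8 * Real.exp (α * β ^ j) ^ 2) ≤ Q / (x * Real.log x) := by
    rw [le_div_iff₀ (by positivity)]
    have h1 : 1 ≤ Real.exp (x / 8) := Real.one_le_exp (by linarith)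
    calc _ ≤ (Real.exp (x / 2) * (9 * Real.exp (x / 8))) * (x * Real.log x) := by
          refine mul_le_mul_of_nonneg_right ?_ (by positivity)
          calc (z : ℝ) ^ 4 + z ^ 4 * (8 * Real.exp (α * β ^ j) ^ 2)
              = z ^ 4 * (1 + 8 * Real.exp (α * β ^ j) ^ 2) := by ring
            _ ≤ _ := by
              gcongr
              linarith
      _ = Real.exp (x / 2) * Real.exp (x / 8) * (9 * (x * Real.log x)) := by ring
      _ ≤ Real.exp (x / 2) * Real.exp (x / 8) * Real.exp (3 / 8 * x) := by gcongr
      _ = Q := by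
          rw [hQx, ← Real.exp_add, ← Real.exp_add]
          congr 1
          ring
  refine hmain.trans ((add_le_add hfirst hsecond).trans_eq ?_)
  ring

end Counting

theorem frequency_P3 (f g : ℤ[X]) (a b : ℤ)
    (hdeg : 2 ≤ f.natDegree)
    (hder : derivative f = g ^ 2 * (C a * X + C b))
    (ha : a ≠ 0)
    (h0 : IsPreperiodicPt f 0)
    (hγ : ¬ IsPreperiodicPt f (-(b : ℚ) / (a : ℚ))) :
    ∃ C : ℝ, 0 < C ∧ ∃ Q₀ : ℕ, ∀ Q : ℕ, Q₀ ≤ Q →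
      (Pf f Q : ℝ) ≤ C * Q / (Real.log Q * Real.log (Real.log Q)) := by
  have hA : f.leadingCoeff ≠ 0 := leadingCoeff_ne_zero.2 (by rintro rfl; simp at hdeg)
  by_cases hc : ∀ k, 1 ≤ k → (polyIter f k).eval 0 ≠ 0
  · obtain ⟨α, β, P, hα, hβ, h⟩ := exists_nonresidue_family hdeg hder ha h0 hγ hc
    refine card_le_of_nonresidue_family hα hβ (P := P) (fun Q p hp => ⟨hp.1, hp.2.1, hp.2.2.1⟩)
      fun j => ?_
    obtain ⟨s, N, hs, hN0, hpair, hNM, hNp⟩ := h j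
    exact ⟨s, N, hs, hN0, hpair, hNM, fun Q hPQ p hp =>
      hNp p hp.1 (hPQ.trans_le hp.2.1) hp.2.2.2⟩
  · push Not at hc
    obtain ⟨k, hk, hk0⟩ := hc
    refine ⟨1, one_pos, max 16 (f.leadingCoeff.natAbs + 1), fun Q hQ => ?_⟩
    have hPf : Pf f Q = 0 := by
      rw [Pf, Set.ncard_eq_zero (hs := (Set.finite_Icc Q (2 * Q)).subset
        fun p hp => ⟨hp.2.1, hp.2.2.1⟩), Set.eq_empty_iff_forall_notMem]
      rintro p ⟨hp, hQp, -, hdyn⟩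
      refine not_dynIrred_of_eval_zero hdeg hk hk0 hp (fun hpA => ?_) hdyn
      have := Nat.le_of_dvd (Int.natAbs_pos.2 hA) (Int.natCast_dvd.1 hpA)
      have := le_of_max_le_right hQ
      omega
    have hlog : 1 ≤ Real.log Q := by
      have h16 : (16 : ℝ) ≤ Q := by exact_mod_cast le_of_max_le_left hQ
      rw [Real.le_log_iff_exp_le (by linarith)]
      have := Real.exp_one_lt_d9
      linarith
    have hlog' := Real.log_nonneg hlog
    rw [hPf, Nat.cast_zero]
    positivity
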